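/- arXiv:2205.12829 — 5 statements merged into one kernel-verified Lean document; each statement's English description precedes it below -/
import Mathlib

section
/- Let A, B, C, D be integers with C ≥ 1 and D ≥ 1 and Φ = Φ_{A,B,C,D}. (i) For every irrational real ξ, with Ξ = (D·ξ², D·ξ, A·ξ² + B·ξ + C) and any Σ ∈ ℝ³ with ⟨Σ,Ξ⟩_Φ = 0 and Σ ∉ ℝ·Ξ, there exists an irrational real η with λ_Φ(Ξ;Σ) = λ(η). (ii) For all distinct irrational reals ξ, ξ', with Ξ, Ξ' the corresponding real points of the conic and any nonzero Σ ∈ ℝ³ with ⟨Σ,Ξ⟩_Φ = ⟨Σ,Ξ'⟩_Φ = 0, there exist distinct irrational reals η, η' with μ_Φ(Σ) = μ(η,η'). In particular, the Lagrange and Markoff spectra of the conic Φ = 0 are contained respectively in the classical Lagrange and Markoff spectra. -/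
noncomputable section
open Filter Topology
open scoped ENNReal LinearAlgebra.Projectivization

abbrev V3 := Fin 3 → ℝ

instance : TopologicalSpace (ℙ ℝ V3) :=
  TopologicalSpace.coinduced (Projectivization.mk' ℝ) inferInstance

/-- The ternary quadratic form `A X² + B XY + C Y² + D XZ + E YZ + F Z²` on `ℝ³`. -/
def Phi6 (A B C D E F : ℤ) (P : V3) : ℝ :=
  A * P 0 ^ 2 + B * P 0 * P 1 + C * P 1 ^ 2 + D * P 0 * P 2 + E * P 1 * P 2 + F * P 2 ^ 2

/-- The discriminant: four times the determinant of the Gram matrix. -/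
def disc6 (A B C D E F : ℤ) : ℤ :=
  4 * A * C * F + B * D * E - A * E ^ 2 - C * D ^ 2 - F * B ^ 2

/-- The bilinear form associated to a quadratic form. -/
def bil (Φ : V3 → ℝ) (P Q : V3) : ℝ := (Φ (P + Q) - Φ P - Φ Q) / 2

def intCast3 (P : Fin 3 → ℤ) : V3 := fun i => (P i : ℝ)

/-- Nonzero integer points on the conic `Φ = 0`. -/
def ConicPts (Φ : V3 → ℝ) := {P : Fin 3 → ℤ // intCast3 P ≠ 0 ∧ Φ (intCast3 P) = 0}

/-- Lagrange approximability `λ_Φ(Ξ; Σ)`: limsup of `√(Δ·|Φ(Σ)|)/|⟨Σ,P⟩|` over nonzero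
integer zeros `P` of `Φ`, along the pullback of the neighborhood filter of `[Ξ]` in `ℙ²(ℝ)`. -/
def lambdaPhi (Φ : V3 → ℝ) (Δ : ℝ) (Ξ Sg : V3) : ℝ≥0∞ :=
  if hΞ : Ξ ≠ 0 then
    Filter.limsup
      (fun P : ConicPts Φ =>
        ENNReal.ofReal (Real.sqrt (Δ * |Φ Sg|) / |bil Φ Sg (intCast3 P.1)|))
      (Filter.comap (fun P : ConicPts Φ => Projectivization.mk ℝ (intCast3 P.1) P.2.1)
        (nhds (Projectivization.mk ℝ Ξ hΞ)))
  else 0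

/-- Markoff approximability `μ_Φ(Σ)`. -/
def muPhi (Φ : V3 → ℝ) (Δ : ℝ) (Sg : V3) : ℝ≥0∞ :=
  ⨆ (P : Fin 3 → ℤ) (_ : intCast3 P ≠ 0) (_ : Φ (intCast3 P) = 0)
    (_ : bil Φ Sg (intCast3 P) ≠ 0),
    ENNReal.ofReal (Real.sqrt (Δ * |Φ Sg|) / |bil Φ Sg (intCast3 P)|)

/-- `Ξ` spans an irrational line: no nonzero integer vector is proportional to `Ξ`. -/
def IrrationalLine (Ξ : V3) : Prop :=
  ∀ P : Fin 3 → ℤ, P ≠ 0 → ∀ c : ℝ, intCast3 P ≠ c • Ξ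

/-- Classical approximability of a real number. -/
def lambdaCl (ξ : ℝ) : ℝ≥0∞ :=
  Filter.limsup (fun q : ℚ => ENNReal.ofReal (1 / ((q.den : ℝ) ^ 2 * |(q : ℝ) - ξ|)))
    (Filter.comap (fun q : ℚ => (q : ℝ)) (nhds ξ))

/-- Classical Markoff approximability of a pair of real numbers. -/
def muCl (η η' : ℝ) : ℝ≥0∞ :=
  ⨆ (st : ℤ × ℤ) (_ : st ≠ 0),
    ENNReal.ofReal (|η - η'| / |((st.1 : ℝ) - st.2 * η) * ((st.1 : ℝ) - st.2 * η')|)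

/-- The `n`-Lagrange approximability. -/
def nLagrange (n : ℕ) (ξ : ℝ) : ℝ≥0∞ :=
  Filter.limsup
    (fun q : ℚ => ENNReal.ofReal ((Nat.gcd q.den n : ℝ) / ((q.den : ℝ) ^ 2 * |(q : ℝ) - ξ|)))
    (Filter.comap (fun q : ℚ => (q : ℝ)) (nhds ξ))

/-- The `n`-Markoff approximability. -/
def nMarkoff (n : ℕ) (ξ ξ' : ℝ) : ℝ≥0∞ :=
  ⨆ (st : ℤ × ℤ) (_ : st ≠ 0),
    ENNReal.ofReal (|ξ - ξ'| * (Int.gcd st.2 (n : ℤ) : ℝ) /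
      |((st.1 : ℝ) - st.2 * ξ) * ((st.1 : ℝ) - st.2 * ξ')|)

/-- The quaternion ring `R_{A,B,C,D}` as a `ℤ`-submodule of `Mat₂(ℤ)`. -/
def Rring (A B C D : ℤ) : Submodule ℤ (Matrix (Fin 2) (Fin 2) ℤ) :=
  Submodule.span ℤ {1, !![B, C; -A, 0], !![0, 0; 0, D], !![0, 0; D, 0]}

/-- The real point of the conic `Φ_{A,B,C,D} = 0` with parameter `ξ`. -/
def XiOf (A B C D : ℤ) (ξ : ℝ) : V3 :=
  ![(D : ℝ) * ξ ^ 2, (D : ℝ) * ξ, (A : ℝ) * ξ ^ 2 + (B : ℝ) * ξ + (C : ℝ)]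

/-- The integral parametrization of the conic by binary quadratic forms. -/
def conicParam (A B C D s t : ℤ) : Fin 3 → ℤ :=
  ![D * s ^ 2, D * s * t, A * s ^ 2 + B * s * t + C * t ^ 2]

/-- The lattice spanned by `(a, 0)` and `(b, c)` is adapted to the conic if the values of the
parametrization on it are divisible by its index. -/
def IsAdapted (A B C D a b c : ℤ) : Prop :=
  ∀ x y : ℤ, ∀ i, a * c ∣ conicParam A B C D (a * x + b * y) (c * y) i

open Classical in
/-- A finite family of lattices adapted to the conic that covers all of its integer points. -/
def adaptedLattices (A B C D : ℤ) : Finset (ℤ × ℤ × ℤ) :=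
  (Finset.Icc 1 (C * D) ×ˢ Finset.Icc 0 (C * D) ×ˢ Finset.Icc 1 (C * D)).filter
    fun m => IsAdapted A B C D m.1 m.2.1 m.2.2

lemma pos_of_mem_adaptedLattices {A B C D : ℤ} {m : ℤ × ℤ × ℤ}
    (hm : m ∈ adaptedLattices A B C D) : 0 < m.1 ∧ 0 < m.2.2 := by
  simp only [adaptedLattices, Finset.mem_filter, Finset.mem_product, Finset.mem_Icc] at hm
  omega

lemma isAdapted_of_mem_adaptedLattices {A B C D : ℤ} {m : ℤ × ℤ × ℤ}
    (hm : m ∈ adaptedLattices A B C D) : IsAdapted A B C D m.1 m.2.1 m.2.2 := by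
  simp only [adaptedLattices, Finset.mem_filter] at hm
  exact hm.2

lemma dvd_mul_of_dvd_conicParam {A B C D s t d : ℤ} (hst : IsCoprime s t)
    (h : ∀ i, d ∣ conicParam A B C D s t i) : d ∣ C * D := by
  obtain ⟨u, v, huv⟩ := hst
  obtain ⟨k0, h0⟩ := h 0
  obtain ⟨k1, h1⟩ := h 1
  obtain ⟨k2, h2⟩ := h 2
  simp only [conicParam, Matrix.cons_val_zero, Matrix.cons_val_one, Matrix.cons_val] at h0 h1 h2
  refine ⟨C * u ^ 2 * k0 + 2 * C * u * v * k1 + v ^ 2 * (D * k2 - A * k0 - B * k1), ?_⟩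
  linear_combination (-(C * D) * (u * s + v * t + 1)) * huv + (C * u ^ 2 - A * v ^ 2) * h0 +
    (2 * C * u * v - B * v ^ 2) * h1 + D * v ^ 2 * h2

/-- The lattice of vectors congruent to a multiple of `(s, t)` modulo `d` is adapted. -/
lemma exists_mem_adaptedLattices {A B C D s t d : ℤ} (hCD : 0 < C * D) (hd : 0 < d)
    (hst : IsCoprime s t) (h : ∀ i, d ∣ conicParam A B C D s t i) :
    ∃ m ∈ adaptedLattices A B C D, m.1 * m.2.2 = d ∧
      ∃ x y : ℤ, s = m.1 * x + m.2.1 * y ∧ t = m.2.2 * y := by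
  have hdle : d ≤ C * D := Int.le_of_dvd hCD (dvd_mul_of_dvd_conicParam hst h)
  obtain ⟨c, a, y, hc, hcop, hca, hcy⟩ :
      ∃ c a y : ℤ, 0 < c ∧ IsCoprime a y ∧ c * a = d ∧ c * y = t := by
    have hg : Int.gcd d t ≠ 0 := by
      rw [Ne, Int.gcd_eq_zero_iff]; omega
    refine ⟨Int.gcd d t, d / Int.gcd d t, t / Int.gcd d t, by positivity, ?_,
      Int.mul_ediv_cancel' (Int.gcd_dvd_left ..), Int.mul_ediv_cancel' (Int.gcd_dvd_right ..)⟩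
    exact Int.isCoprime_iff_gcd_eq_one.2 (Int.gcd_ediv_gcd_ediv_gcd (Nat.pos_of_ne_zero hg))
  have ha : 0 < a := by
    by_contra! hn
    nlinarith
  obtain ⟨p, q, hpq⟩ := hcop
  obtain ⟨u, v, huv⟩ := hst
  set b := (s * q) % a with hb
  have hb0 : 0 ≤ b := Int.emod_nonneg _ ha.ne'
  have hba : b < a := Int.emod_lt_of_pos _ ha
  have hbq : b + a * (s * q / a) = s * q := Int.emod_add_mul_ediv _ _
  have hs : s = a * (s * p + y * (s * q / a)) + b * y := by
    linear_combination (-s) * hpq - y * hbq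
  set x := s * p + y * (s * q / a)
  refine ⟨(a, b, c), ?_, by linarith, x, y, hs, hcy.symm⟩
  simp only [adaptedLattices, Finset.mem_filter, Finset.mem_product, Finset.mem_Icc]
  refine ⟨⟨⟨ha, by nlinarith⟩, ⟨hb0, by nlinarith⟩, ⟨hc, by nlinarith⟩⟩, ?_⟩
  intro x' y'
  set s' := a * x' + b * y' with hs'
  set t' := c * y' with ht'
  have hdet : s * t' - t * s' = d * (x * y' - y * x') := by
    rw [hs', ht', ← hcy, ← hca]; linear_combination c * y' * hs
  set e := u * s' + v * t' with he
  set n := x * y' - y * x'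
  have es : s' = s * e - d * (v * n) := by
    rw [he]; linear_combination (-s') * huv - v * hdet
  have et : t' = t * e + d * (u * n) := by
    rw [he]; linear_combination (-t') * huv + u * hdet
  have key : ∀ i, conicParam A B C D s' t' i ≡ e ^ 2 * conicParam A B C D s t i [ZMOD d] := by
    have hsm : s' ≡ s * e [ZMOD d] := by
      rw [es]; exact (Int.modEq_iff_dvd.2 ⟨v * n, by ring⟩)
    have htm : t' ≡ t * e [ZMOD d] := by
      rw [et]; exact (Int.modEq_iff_dvd.2 ⟨-(u * n), by ring⟩)
    intro i
    fin_cases i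
    · calc D * s' ^ 2 ≡ D * (s * e) ^ 2 [ZMOD d] := (hsm.pow 2).mul_left D
        _ = e ^ 2 * (D * s ^ 2) := by ring
    · calc D * s' * t' ≡ D * (s * e) * (t * e) [ZMOD d] := (hsm.mul_left D).mul htm
        _ = e ^ 2 * (D * s * t) := by ring
    · calc A * s' ^ 2 + B * s' * t' + C * t' ^ 2
          ≡ A * (s * e) ^ 2 + B * (s * e) * (t * e) + C * (t * e) ^ 2 [ZMOD d] :=
          (((hsm.pow 2).mul_left A).add ((hsm.mul_left B).mul htm)).add ((htm.pow 2).mul_left C)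
        _ = e ^ 2 * (A * s ^ 2 + B * s * t + C * t ^ 2) := by ring
  intro i
  rw [mul_comm a c, hca]
  exact (Int.modEq_zero_iff_dvd.1 ((key i).trans
    (Int.modEq_zero_iff_dvd.2 (Dvd.dvd.mul_left (h i) _))))

/-- An integer vector that is a rational multiple of `w` is an integer multiple of the primitive
vector on its line. -/
lemma exists_gcd_mul_eq {w P : Fin 3 → ℤ} (hw : w ≠ 0) {p q : ℤ} (hp : p ≠ 0)
    (h : ∀ i, p * P i = q * w i) :
    ∃ d k : ℤ, 0 < d ∧ (∀ i, d ∣ w i) ∧ ∀ i, d * P i = k * w i := by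
  set d := Finset.univ.gcd w with hd
  have hd0 : d ≠ 0 := by
    intro h0
    exact hw (funext fun i => Finset.gcd_eq_zero_iff.1 h0 i (Finset.mem_univ i))
  have hdpos : 0 < d := lt_of_le_of_ne (by
    rw [hd, ← Finset.normalize_gcd]
    exact Int.nonneg_of_normalize_eq_self (normalize_idem _)) hd0.symm
  have hdvd : ∀ i, d ∣ w i := fun i => Finset.gcd_dvd (Finset.mem_univ i)
  obtain ⟨β, hβ⟩ := Finset.gcd_eq_sum_mul Finset.univ w
  refine ⟨d, ∑ i, P i * β i, hdpos, hdvd, fun i => ?_⟩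
  apply mul_left_cancel₀ hp
  have : p * ∑ j, P j * β j = q * d := by
    rw [hd, hβ, Finset.mul_sum, Finset.mul_sum]
    exact Finset.sum_congr rfl fun j _ => by linear_combination β j * h j
  linear_combination d * h i - w i * this

lemma exists_adapted_param {A B C D : ℤ} (hC : 1 ≤ C) (hD : 1 ≤ D) {P : Fin 3 → ℤ}
    (hP : P ≠ 0) (h : D * P 0 * P 2 = A * P 0 ^ 2 + B * P 0 * P 1 + C * P 1 ^ 2) :
    ∃ m ∈ adaptedLattices A B C D, ∃ x y k : ℤ, k ≠ 0 ∧ ∀ i, m.1 * m.2.2 * P i =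
      k * conicParam A B C D (m.1 * x + m.2.1 * y) (m.2.2 * y) i := by
  obtain ⟨s, t, p, q, hst, hp, hpq⟩ : ∃ s t p q : ℤ, IsCoprime s t ∧ p ≠ 0 ∧
      ∀ i, p * P i = q * conicParam A B C D s t i := by
    by_cases h0 : P 0 = 0
    · have h1 : P 1 = 0 := by
        have : C * P 1 ^ 2 = 0 := by rw [h0] at h; linarith
        rcases mul_eq_zero.1 this with h' | h'
        · omega
        · exact pow_eq_zero_iff two_ne_zero |>.1 h'
      refine ⟨0, 1, C, P 2, isCoprime_zero_left.2 isUnit_one, by omega, fun i => ?_⟩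
      fin_cases i
      · simp [conicParam, h0]
      · simp [conicParam, h1]
      · simp [conicParam, mul_comm]
    · have hg : Int.gcd (P 0) (P 1) ≠ 0 := by
        rw [Ne, Int.gcd_eq_zero_iff]; tauto
      obtain ⟨g, s, t, hg, hcop, hgs, hgt⟩ :
          ∃ g s t : ℤ, g ≠ 0 ∧ IsCoprime s t ∧ g * s = P 0 ∧ g * t = P 1 :=
        ⟨Int.gcd (P 0) (P 1), P 0 / Int.gcd (P 0) (P 1), P 1 / Int.gcd (P 0) (P 1),
          by exact_mod_cast hg,
          Int.isCoprime_iff_gcd_eq_one.2 (Int.gcd_ediv_gcd_ediv_gcd (Nat.pos_of_ne_zero hg)),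
          Int.mul_ediv_cancel' (Int.gcd_dvd_left ..), Int.mul_ediv_cancel' (Int.gcd_dvd_right ..)⟩
      have hs : s ≠ 0 := by rintro rfl; simp at hgs; exact h0 hgs.symm
      refine ⟨s, t, D * s, g, hcop, mul_ne_zero (by omega) hs, fun i => ?_⟩
      fin_cases i
      · simp [conicParam, ← hgs]; ring
      · simp [conicParam, ← hgt]; ring
      · simp only [conicParam, Fin.reduceFinMk, Matrix.cons_val]
        apply mul_left_cancel₀ hg
        rw [← hgs, ← hgt] at h
        linear_combination h
  have hw : conicParam A B C D s t ≠ 0 := by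
    intro h0
    apply hP
    funext i
    have := hpq i
    rw [h0] at this
    simpa [hp] using this
  obtain ⟨d, k, hd, hdvd, hk⟩ := exists_gcd_mul_eq hw hp hpq
  obtain ⟨m, hm, hmd, x, y, hs, ht⟩ :=
    exists_mem_adaptedLattices (mul_pos (by omega) (by omega)) hd hst hdvd
  refine ⟨m, hm, x, y, k, ?_, fun i => ?_⟩
  · rintro rfl
    apply hP
    funext i
    have := hk i
    simp only [zero_mul, mul_eq_zero, hd.ne', false_or] at this
    exact this
  · rw [hmd, ← hs, ← ht]; exact hk i

lemma phi_conicParam (A B C D s t : ℤ) :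
    Phi6 (-A) (-B) (-C) D 0 0 (intCast3 (conicParam A B C D s t)) = 0 := by
  simp only [Phi6, intCast3, conicParam, Matrix.cons_val_zero, Matrix.cons_val_one,
    Matrix.cons_val]
  push_cast
  ring

lemma conicParam_ne_zero {A B C D s t : ℤ} (hC : 1 ≤ C) (hD : 1 ≤ D) (h : s ≠ 0 ∨ t ≠ 0) :
    conicParam A B C D s t ≠ 0 := by
  intro h0
  have e0 := congrFun h0 0
  have e2 := congrFun h0 2
  simp only [conicParam, Matrix.cons_val_zero, Matrix.cons_val, Pi.zero_apply] at e0 e2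
  have hs : s = 0 := by
    rcases mul_eq_zero.1 e0 with h' | h'
    · omega
    · exact pow_eq_zero_iff two_ne_zero |>.1 h'
  subst hs
  have : C * t ^ 2 = 0 := by linarith
  rcases mul_eq_zero.1 this with h' | h'
  · omega
  · have := pow_eq_zero_iff two_ne_zero |>.1 h'
    tauto

lemma intCast3_eq_zero {P : Fin 3 → ℤ} : intCast3 P = 0 ↔ P = 0 := by
  simp [funext_iff, intCast3]

lemma phi_intCast3_eq_zero_iff {A B C D : ℤ} {P : Fin 3 → ℤ} :
    Phi6 (-A) (-B) (-C) D 0 0 (intCast3 P) = 0 ↔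
      D * P 0 * P 2 = A * P 0 ^ 2 + B * P 0 * P 1 + C * P 1 ^ 2 := by
  simp only [Phi6, intCast3]
  rw [← Int.cast_inj (α := ℝ)]
  push_cast
  constructor <;> intro h <;> linarith

lemma bil_phi (A B C D : ℤ) (S T : V3) : bil (Phi6 (-A) (-B) (-C) D 0 0) S T =
    -A * S 0 * T 0 - B * (S 0 * T 1 + S 1 * T 0) / 2 - C * S 1 * T 1 +
      D * (S 0 * T 2 + S 2 * T 0) / 2 := by
  simp only [bil, Phi6, Pi.add_apply]
  push_cast
  ring

lemma bil_smul_right (A B C D : ℤ) (r : ℝ) (S T : V3) :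
    bil (Phi6 (-A) (-B) (-C) D 0 0) S (r • T) = r * bil (Phi6 (-A) (-B) (-C) D 0 0) S T := by
  simp only [bil_phi, Pi.smul_apply, smul_eq_mul]
  ring

/-- The leading coefficient of the quadratic polynomial `r ↦ ⟨Σ, XiOf r⟩`. -/
def leadCoeff (A B D : ℤ) (S : V3) : ℝ := D * (D * S 2 - A * S 0 - B * S 1) / 2

lemma bil_XiOf (A B C D : ℤ) (S : V3) (r : ℝ) :
    bil (Phi6 (-A) (-B) (-C) D 0 0) S (XiOf A B C D r) =
      leadCoeff A B D S * r ^ 2 - C * D * S 1 * r + C * D * S 0 / 2 := by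
  simp only [bil_phi, XiOf, leadCoeff, Matrix.cons_val_zero, Matrix.cons_val_one, Matrix.cons_val]
  ring

lemma bil_conicParam (A B C D s t : ℤ) (S : V3) :
    bil (Phi6 (-A) (-B) (-C) D 0 0) S (intCast3 (conicParam A B C D s t)) =
      leadCoeff A B D S * s ^ 2 - C * D * S 1 * s * t + C * D * S 0 / 2 * t ^ 2 := by
  simp only [bil_phi, conicParam, intCast3, leadCoeff, Matrix.cons_val_zero, Matrix.cons_val_one,
    Matrix.cons_val]
  push_cast
  ring

lemma sqrt_disc_mul_abs_phi {A B C D : ℤ} (S : V3) {δ : ℝ}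
    (hδ : (C * D * S 1) ^ 2 - 4 * leadCoeff A B D S * (C * D * S 0 / 2) = δ ^ 2) (hC : 1 ≤ C) :
    √((C : ℝ) * (D : ℝ) ^ 2 * |Phi6 (-A) (-B) (-C) D 0 0 S|) = |δ| := by
  have h : (0 : ℝ) ≤ C * D ^ 2 := by
    have : (0 : ℝ) ≤ C := by exact_mod_cast (by omega : 0 ≤ C)
    positivity
  rw [← abs_of_nonneg h, ← abs_mul, ← abs_neg, ← Real.sqrt_sq_eq_abs δ, ← abs_sq δ, ← hδ]
  congr 2
  simp only [Phi6, leadCoeff]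
  push_cast
  ring

/-- The integer point of the conic attached to a vector of an adapted lattice. -/
def adaptedPoint (A B C D a b c x y : ℤ) : Fin 3 → ℤ := fun i =>
  conicParam A B C D (a * x + b * y) (c * y) i / (a * c)

lemma mul_adaptedPoint {A B C D a b c : ℤ} (h : IsAdapted A B C D a b c) (x y : ℤ) (i : Fin 3) :
    a * c * adaptedPoint A B C D a b c x y i =
      conicParam A B C D (a * x + b * y) (c * y) i :=
  Int.mul_ediv_cancel' (h x y i)

lemma intCast3_of_mul_eq {a c k : ℤ} (ha : 0 < a) (hc : 0 < c) {P w : Fin 3 → ℤ}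
    (h : ∀ i, a * c * P i = k * w i) : intCast3 P = ((k : ℝ) / (a * c)) • intCast3 w := by
  funext i
  have ha' : (a : ℝ) ≠ 0 := by exact_mod_cast ha.ne'
  have hc' : (c : ℝ) ≠ 0 := by exact_mod_cast hc.ne'
  have : (a : ℝ) * c * P i = k * w i := by exact_mod_cast h i
  simp only [intCast3, Pi.smul_apply, smul_eq_mul]
  field_simp
  linarith

lemma adaptedPoint_mem_conic {A B C D a b c x y : ℤ} (hC : 1 ≤ C) (hD : 1 ≤ D) (ha : 0 < a)
    (hc : 0 < c) (h : IsAdapted A B C D a b c) (hxy : x ≠ 0 ∨ y ≠ 0) :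
    intCast3 (adaptedPoint A B C D a b c x y) ≠ 0 ∧
      Phi6 (-A) (-B) (-C) D 0 0 (intCast3 (adaptedPoint A B C D a b c x y)) = 0 := by
  have hmul := mul_adaptedPoint h x y
  constructor
  · rw [Ne, intCast3_eq_zero]
    intro h0
    refine conicParam_ne_zero (A := A) (B := B) hC hD (s := a * x + b * y) (t := c * y) ?_ ?_
    · by_contra! hn
      obtain ⟨h1, h2⟩ := hn
      have hy : y = 0 := by simpa [hc.ne'] using h2
      subst hy
      have hx : x = 0 := by simpa [ha.ne'] using h1
      simp_all
    · funext i
      rw [← hmul i, h0]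
      simp
  · have e := intCast3_of_mul_eq ha hc (k := 1) (fun i => by rw [hmul i, one_mul])
    have := phi_conicParam A B C D (a * x + b * y) (c * y)
    rw [e]
    simp only [Phi6, Pi.smul_apply, smul_eq_mul] at this ⊢
    linear_combination (((1 : ℤ) : ℝ) / (a * c)) ^ 2 * this

lemma adaptedLattices_nonempty {A B C D : ℤ} (hC : 1 ≤ C) (hD : 1 ≤ D) :
    (adaptedLattices A B C D).Nonempty := by
  obtain ⟨m, hm, -⟩ := exists_adapted_param (A := A) (B := B) hC hD (P := ![0, 0, 1])
    (fun h => by simpa using congrFun h 2) (by simp)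
  exact ⟨m, hm⟩

/-- The parameter `ξ` in the coordinates of the lattice `m`. -/
def latticeCoord (m : ℤ × ℤ × ℤ) (ξ : ℝ) : ℝ := (m.2.2 * ξ - m.2.1) / m.1

lemma irrational_latticeCoord {m : ℤ × ℤ × ℤ} (ha : 0 < m.1) (hc : 0 < m.2.2) {ξ : ℝ}
    (hξ : Irrational ξ) : Irrational (latticeCoord m ξ) :=
  ((hξ.intCast_mul hc.ne').sub_intCast _).div_intCast ha.ne'

lemma Irrational.sub_mul_ne_zero {ξ : ℝ} (hξ : Irrational ξ) {s t : ℤ} (h : s ≠ 0 ∨ t ≠ 0) :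
    (s : ℝ) - t * ξ ≠ 0 := by
  by_cases ht : t = 0
  · subst ht
    have : s ≠ 0 := by tauto
    simpa using this
  · intro h0
    exact (hξ.intCast_mul ht).ne_int s (by linarith)

/-- The value at `(x, y)` of the form attached to a pair of reals, in lattice coordinates. -/
lemma sub_mul_latticeCoord {m : ℤ × ℤ × ℤ} (ha : 0 < m.1) (x y : ℤ) (ξ : ℝ) :
    ((m.1 * x + m.2.1 * y : ℤ) : ℝ) - (m.2.2 * y : ℤ) * ξ =
      m.1 * (x - y * latticeCoord m ξ) := by
  have ha' : (m.1 : ℝ) ≠ 0 := by exact_mod_cast ha.ne'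
  simp only [latticeCoord]
  push_cast
  field_simp
  ring

lemma latticeCoord_sub {m : ℤ × ℤ × ℤ} (ξ ξ' : ℝ) :
    latticeCoord m ξ - latticeCoord m ξ' = m.2.2 / m.1 * (ξ - ξ') := by
  simp only [latticeCoord]
  ring

lemma exists_ne_zero_of_adapted_param {A B C D : ℤ} {m : ℤ × ℤ × ℤ} {x y k : ℤ}
    (ha : 0 < m.1) (hc : 0 < m.2.2) {P : Fin 3 → ℤ} (hP : P ≠ 0)
    (h : ∀ i, m.1 * m.2.2 * P i =
      k * conicParam A B C D (m.1 * x + m.2.1 * y) (m.2.2 * y) i) : x ≠ 0 ∨ y ≠ 0 := by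
  by_contra! hn
  obtain ⟨rfl, rfl⟩ := hn
  apply hP
  funext i
  have hi := h i
  have : conicParam A B C D 0 0 i = 0 := by fin_cases i <;> simp [conicParam]
  simp only [mul_zero, add_zero, this, mul_eq_zero, ha.ne', hc.ne', false_or] at hi
  exact hi

/-- The quantity defining `muPhi`, at a multiple of a point of an adapted lattice. -/
lemma markoff_term_eq {A B C D : ℤ} {S : V3} {κ ξ ξ' : ℝ} (hκ : κ ≠ 0)
    (hS : ∀ s t : ℤ, bil (Phi6 (-A) (-B) (-C) D 0 0) S (intCast3 (conicParam A B C D s t)) =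
      κ * ((s - t * ξ) * (s - t * ξ')))
    {m : ℤ × ℤ × ℤ} (ha : 0 < m.1) (hc : 0 < m.2.2) {x y k : ℤ} {P : Fin 3 → ℤ}
    (h : ∀ i, m.1 * m.2.2 * P i =
      k * conicParam A B C D (m.1 * x + m.2.1 * y) (m.2.2 * y) i) :
    |κ * (ξ - ξ')| / |bil (Phi6 (-A) (-B) (-C) D 0 0) S (intCast3 P)| =
      |latticeCoord m ξ - latticeCoord m ξ'| /
        |((x : ℝ) - y * latticeCoord m ξ) * ((x : ℝ) - y * latticeCoord m ξ')| / |(k : ℝ)| := by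
  have ha' : (0 : ℝ) < m.1 := by exact_mod_cast ha
  have hc' : (0 : ℝ) < m.2.2 := by exact_mod_cast hc
  rw [intCast3_of_mul_eq ha hc h, bil_smul_right, hS, sub_mul_latticeCoord ha,
    sub_mul_latticeCoord ha, latticeCoord_sub]
  rw [← abs_div, ← abs_div, ← abs_div]
  congr 1
  field_simp

lemma muPhi_eq_biSup {A B C D : ℤ} (hC : 1 ≤ C) (hD : 1 ≤ D) {S : V3} {Δ κ ξ ξ' : ℝ}
    (hκ : κ ≠ 0) (hξ : Irrational ξ) (hξ' : Irrational ξ')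
    (hS : ∀ s t : ℤ, bil (Phi6 (-A) (-B) (-C) D 0 0) S (intCast3 (conicParam A B C D s t)) =
      κ * ((s - t * ξ) * (s - t * ξ')))
    (hΔ : √(Δ * |Phi6 (-A) (-B) (-C) D 0 0 S|) = |κ * (ξ - ξ')|) :
    muPhi (Phi6 (-A) (-B) (-C) D 0 0) Δ S =
      ⨆ m ∈ adaptedLattices A B C D, muCl (latticeCoord m ξ) (latticeCoord m ξ') := by
  simp only [muPhi, hΔ]
  apply le_antisymm
  · refine iSup_le fun P => iSup_le fun hP => iSup_le fun hΦ => iSup_le fun _ => ?_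
    have hP' : P ≠ 0 := fun h => hP (intCast3_eq_zero.2 h)
    obtain ⟨m, hm, x, y, k, hk, h⟩ :=
      exists_adapted_param hC hD hP' (phi_intCast3_eq_zero_iff.1 hΦ)
    obtain ⟨ha, hc⟩ := pos_of_mem_adaptedLattices hm
    refine le_trans ?_ (le_biSup (fun m => muCl (latticeCoord m ξ) (latticeCoord m ξ')) hm)
    have hxy : ((x, y) : ℤ × ℤ) ≠ 0 := by
      have := exists_ne_zero_of_adapted_param ha hc hP' h
      simp only [Ne, Prod.mk_eq_zero]
      tauto
    refine le_trans ?_ (le_biSup (fun st : ℤ × ℤ => ENNReal.ofReal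
      (|latticeCoord m ξ - latticeCoord m ξ'| / |((st.1 : ℝ) - st.2 * latticeCoord m ξ) *
        ((st.1 : ℝ) - st.2 * latticeCoord m ξ')|)) (show (x, y) ∈ {st : ℤ × ℤ | st ≠ 0} from hxy))
    apply ENNReal.ofReal_le_ofReal
    rw [markoff_term_eq hκ hS ha hc h]
    apply div_le_self (by positivity)
    exact_mod_cast Int.one_le_abs hk
  · refine iSup₂_le fun m hm => iSup₂_le fun st hst => ?_
    obtain ⟨ha, hc⟩ := pos_of_mem_adaptedLattices hm
    have had := isAdapted_of_mem_adaptedLattices hm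
    have hxy : st.1 ≠ 0 ∨ st.2 ≠ 0 := by
      by_contra! hn
      exact hst (Prod.ext hn.1 hn.2)
    obtain ⟨hP, hΦ⟩ := adaptedPoint_mem_conic hC hD ha hc had hxy
    have h : ∀ i, m.1 * m.2.2 * adaptedPoint A B C D m.1 m.2.1 m.2.2 st.1 st.2 i =
        1 * conicParam A B C D (m.1 * st.1 + m.2.1 * st.2) (m.2.2 * st.2) i :=
      fun i => by rw [mul_adaptedPoint had, one_mul]
    have hst' : m.1 * st.1 + m.2.1 * st.2 ≠ 0 ∨ m.2.2 * st.2 ≠ 0 := by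
      by_contra! hn
      obtain ⟨h1, h2⟩ := hn
      have hy : st.2 = 0 := by simpa [hc.ne'] using h2
      rw [hy] at h1
      have hx : st.1 = 0 := by simpa [ha.ne'] using h1
      tauto
    have hb : bil (Phi6 (-A) (-B) (-C) D 0 0) S
        (intCast3 (adaptedPoint A B C D m.1 m.2.1 m.2.2 st.1 st.2)) ≠ 0 := by
      rw [intCast3_of_mul_eq ha hc h, bil_smul_right, hS]
      have ha' : (m.1 : ℝ) ≠ 0 := by exact_mod_cast ha.ne'
      have hc' : (m.2.2 : ℝ) ≠ 0 := by exact_mod_cast hc.ne'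
      exact mul_ne_zero (by simp [ha', hc']) (mul_ne_zero hκ (mul_ne_zero
        (hξ.sub_mul_ne_zero hst') (hξ'.sub_mul_ne_zero hst')))
    refine le_trans (le_of_eq ?_) (le_iSup_of_le _ (le_iSup_of_le hP (le_iSup_of_le hΦ
      (le_iSup_of_le hb le_rfl))))
    rw [markoff_term_eq hκ hS ha hc h]
    simp

/-- A quadratic polynomial with two distinct roots. -/
lemma eq_mul_of_quadratic_roots {k l n ξ ξ' : ℝ} (hne : ξ ≠ ξ') (h : k * ξ ^ 2 - l * ξ + n = 0)
    (h' : k * ξ' ^ 2 - l * ξ' + n = 0) : l = k * (ξ + ξ') ∧ n = k * (ξ * ξ') := by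
  have hl : l = k * (ξ + ξ') := by
    apply mul_left_cancel₀ (sub_ne_zero.2 hne)
    linear_combination h' - h
  exact ⟨hl, by linear_combination h + ξ * hl⟩

lemma exists_muPhi_eq_muCl {A B C D : ℤ} (hC : 1 ≤ C) (hD : 1 ≤ D) {ξ ξ' : ℝ}
    (hξ : Irrational ξ) (hξ' : Irrational ξ') (hne : ξ ≠ ξ') {S : V3} (hS : S ≠ 0)
    (h : bil (Phi6 (-A) (-B) (-C) D 0 0) S (XiOf A B C D ξ) = 0)
    (h' : bil (Phi6 (-A) (-B) (-C) D 0 0) S (XiOf A B C D ξ') = 0) :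
    ∃ η η' : ℝ, Irrational η ∧ Irrational η' ∧ η ≠ η' ∧
      muPhi (Phi6 (-A) (-B) (-C) D 0 0) ((C : ℝ) * (D : ℝ) ^ 2) S = muCl η η' := by
  rw [bil_XiOf] at h h'
  obtain ⟨hl, hn⟩ := eq_mul_of_quadratic_roots hne h h'
  have hC' : (C : ℝ) ≠ 0 := by exact_mod_cast (by omega : C ≠ 0)
  have hD' : (D : ℝ) ≠ 0 := by exact_mod_cast (by omega : D ≠ 0)
  have hκ : leadCoeff A B D S ≠ 0 := by
    intro h0
    rw [h0, zero_mul] at hl hn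
    have h1 : S 1 = 0 := by simpa [hC', hD'] using hl
    have h2 : S 0 = 0 := by simpa [hC', hD'] using hn
    have h3 : S 2 = 0 := by simpa [leadCoeff, h1, h2, hD'] using h0
    exact hS (funext fun i => by fin_cases i <;> assumption)
  have hmu := muPhi_eq_biSup (Δ := C * D ^ 2) hC hD hκ hξ hξ'
    (fun s t => by rw [bil_conicParam]; linear_combination (-s * t) * hl + t ^ 2 * hn)
    (sqrt_disc_mul_abs_phi S (by rw [hl, hn]; ring) hC)
  obtain ⟨m, hm, hmax⟩ := Finset.exists_mem_eq_sup _ (adaptedLattices_nonempty hC hD)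
    fun m => muCl (latticeCoord m ξ) (latticeCoord m ξ')
  obtain ⟨ha, hc⟩ := pos_of_mem_adaptedLattices hm
  refine ⟨_, _, irrational_latticeCoord ha hc hξ, irrational_latticeCoord ha hc hξ', ?_,
    by rw [hmu, ← Finset.sup_eq_iSup, hmax]⟩
  rw [← sub_ne_zero, latticeCoord_sub]
  have ha' : (m.1 : ℝ) ≠ 0 := by exact_mod_cast ha.ne'
  have hc' : (m.2.2 : ℝ) ≠ 0 := by exact_mod_cast hc.ne'
  exact mul_ne_zero (div_ne_zero hc' ha') (sub_ne_zero.2 hne)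

lemma XiOf_ne_zero {A B C D : ℤ} (hC : 1 ≤ C) (hD : 1 ≤ D) (r : ℝ) : XiOf A B C D r ≠ 0 := by
  intro h
  have h0 := congrFun h 0
  have h2 := congrFun h 2
  have hC' : (C : ℝ) ≠ 0 := by exact_mod_cast (by omega : C ≠ 0)
  have hD' : (D : ℝ) ≠ 0 := by exact_mod_cast (by omega : D ≠ 0)
  simp only [XiOf, Matrix.cons_val_zero, Matrix.cons_val, Pi.zero_apply] at h0 h2
  have hr : r = 0 := by simpa [hD'] using h0
  subst hr
  simp [hC'] at h2

lemma intCast3_eq_smul_XiOf {A B C D : ℤ} {P : Fin 3 → ℤ} (hD : 1 ≤ D) (h0 : P 0 ≠ 0)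
    (h1 : P 1 ≠ 0) (h : Phi6 (-A) (-B) (-C) D 0 0 (intCast3 P) = 0) :
    intCast3 P = ((P 1 : ℝ) / (D * (P 0 / P 1))) • XiOf A B C D (P 0 / P 1) := by
  have hD' : (D : ℝ) ≠ 0 := by exact_mod_cast (by omega : D ≠ 0)
  have h0' : (P 0 : ℝ) ≠ 0 := by exact_mod_cast h0
  have h1' : (P 1 : ℝ) ≠ 0 := by exact_mod_cast h1
  have h' : (D : ℝ) * P 0 * P 2 = A * P 0 ^ 2 + B * P 0 * P 1 + C * P 1 ^ 2 := by
    exact_mod_cast phi_intCast3_eq_zero_iff.1 h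
  funext i
  fin_cases i
  · simp only [intCast3, XiOf, Pi.smul_apply, smul_eq_mul, Fin.zero_eta, Matrix.cons_val_zero]
    field_simp
  · simp only [intCast3, XiOf, Pi.smul_apply, smul_eq_mul, Fin.mk_one, Matrix.cons_val_one,
      Matrix.cons_val_zero]
    field_simp
  · simp only [intCast3, XiOf, Pi.smul_apply, smul_eq_mul, Fin.reduceFinMk, Matrix.cons_val]
    field_simp
    linarith

/-- The affine coordinate `X / Y` of an integer point of a conic. -/
def ConicPts.ratio {Φ : V3 → ℝ} (P : ConicPts Φ) : ℝ := P.1 0 / P.1 1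

lemma ConicPts.coord_ne_zero {Φ : V3 → ℝ} {P : ConicPts Φ} (h : P.ratio ≠ 0) :
    P.1 0 ≠ 0 ∧ P.1 1 ≠ 0 := by
  constructor <;> intro h0 <;> exact h (by simp [ConicPts.ratio, h0])

lemma continuous_mk_XiOf {A B C D : ℤ} (hC : 1 ≤ C) (hD : 1 ≤ D) :
    Continuous fun r : ℝ => Projectivization.mk ℝ (XiOf A B C D r) (XiOf_ne_zero hC hD r) := by
  have h1 : Continuous (Projectivization.mk' ℝ : {v : V3 // v ≠ 0} → ℙ ℝ V3) :=
    continuous_coinduced_rng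
  have h2 : Continuous fun r : ℝ => XiOf A B C D r := by
    refine continuous_pi fun i => ?_
    fin_cases i <;> simp only [XiOf] <;> simp <;> fun_prop
  exact h1.comp (h2.subtype_mk fun r => XiOf_ne_zero hC hD r)

/-- Convergence of integer points of the conic in the projective plane is convergence of their
affine coordinate. -/
lemma comap_nhds_mk_XiOf {A B C D : ℤ} (hC : 1 ≤ C) (hD : 1 ≤ D) {ξ : ℝ} (hξ : ξ ≠ 0) :
    Filter.comap (fun P : ConicPts (Phi6 (-A) (-B) (-C) D 0 0) =>
      Projectivization.mk ℝ (intCast3 P.1) P.2.1)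
      (𝓝 (Projectivization.mk ℝ (XiOf A B C D ξ) (XiOf_ne_zero hC hD ξ))) =
    Filter.comap ConicPts.ratio (𝓝 ξ) := by
  have hD' : (D : ℝ) ≠ 0 := by exact_mod_cast (by omega : D ≠ 0)
  apply le_antisymm
  · rw [← Filter.tendsto_iff_comap]
    intro U hU
    obtain ⟨V, hVU, hV, hξV⟩ := mem_nhds_iff.1 (inter_mem hU (isOpen_ne.mem_nhds hξ))
    let φ : ℙ ℝ V3 → ℝ := Projectivization.lift (fun v : {v : V3 // v ≠ 0} => v.1 0 / v.1 1) (by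
      rintro a b t hab
      have ht : t ≠ 0 := by
        rintro rfl
        exact a.2 (by rw [hab, zero_smul])
      simp only [hab, Pi.smul_apply, smul_eq_mul]
      exact mul_div_mul_left _ _ ht)
    have hφ : IsOpen (φ ⁻¹' V) := by
      rw [isOpen_coinduced]
      have : Projectivization.mk' ℝ ⁻¹' (φ ⁻¹' V) =
          {v : {v : V3 // v ≠ 0} | v.1 0 / v.1 1 ∈ V} := rfl
      rw [this, isOpen_iff_mem_nhds]
      intro v hv
      have hv1 : v.1 1 ≠ 0 := by
        intro h
        have := (hVU hv).2
        simp [h] at this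
      have hi : ∀ i, Continuous fun v : {v : V3 // v ≠ 0} => v.1 i :=
        fun i => (continuous_apply i).comp continuous_subtype_val
      have hc : ContinuousAt (fun v : {v : V3 // v ≠ 0} => v.1 0 / v.1 1) v :=
        (hi 0).continuousAt.div (hi 1).continuousAt hv1
      exact hc (hV.mem_nhds hv)
    have hmem : φ ⁻¹' V ∈ 𝓝 (Projectivization.mk ℝ (XiOf A B C D ξ) (XiOf_ne_zero hC hD ξ)) := by
      apply hφ.mem_nhds
      change XiOf A B C D ξ 0 / XiOf A B C D ξ 1 ∈ V
      convert hξV using 1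
      simp only [XiOf, Matrix.cons_val_zero, Matrix.cons_val_one]
      field_simp
    exact Filter.mem_map.2 (Filter.mem_of_superset (Filter.preimage_mem_comap hmem)
      fun P hP => (hVU hP).1)
  · rw [← Filter.tendsto_iff_comap]
    have ht : Tendsto ConicPts.ratio (comap (ConicPts.ratio (Φ := Phi6 (-A) (-B) (-C) D 0 0))
      (𝓝 ξ)) (𝓝 ξ) := tendsto_comap
    refine (((continuous_mk_XiOf (A := A) (B := B) hC hD).tendsto ξ).comp ht).congr' ?_
    filter_upwards [ht.eventually_ne hξ] with P hP
    obtain ⟨h0, h1⟩ := ConicPts.coord_ne_zero hP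
    have h0' : (P.1 0 : ℝ) ≠ 0 := by exact_mod_cast h0
    have h1' : (P.1 1 : ℝ) ≠ 0 := by exact_mod_cast h1
    have e := intCast3_eq_smul_XiOf hD h0 h1 P.2.2
    symm
    rw [Function.comp_apply, Projectivization.mk_eq_mk_iff']
    exact ⟨_, e.symm⟩

/-- Multiplying by a factor that tends to `1` does not change the limit superior. -/
lemma limsup_mul_of_tendsto_one {α : Type*} {l : Filter α} {u ρ : α → ℝ≥0∞}
    (hρ : Tendsto ρ l (𝓝 1)) : limsup (fun x => u x * ρ x) l = limsup u l := by
  rcases l.eq_or_neBot with rfl | hl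
  · simp
  have key : ∀ {v σ : α → ℝ≥0∞}, Tendsto σ l (𝓝 1) →
      limsup (fun x => v x * σ x) l ≤ limsup v l := by
    intro v σ hσ
    have := ENNReal.limsup_mul_le' (f := l) (u := v) (v := σ)
      (Or.inr (by rw [hσ.limsup_eq]; simp)) (Or.inr (by rw [hσ.limsup_eq]; simp))
    rwa [hσ.limsup_eq, mul_one] at this
  apply le_antisymm (key hρ)
  have hinv : Tendsto (fun x => (ρ x)⁻¹) l (𝓝 1) := by
    simpa using tendsto_inv_iff.2 hρ
  refine le_trans (le_of_eq ?_) (key (v := fun x => u x * ρ x) hinv)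
  apply limsup_congr
  filter_upwards [hρ.eventually_ne (one_ne_zero), hρ.eventually_ne ENNReal.one_ne_top] with x h0 h1
  rw [mul_assoc, ENNReal.mul_inv_cancel h0 h1, mul_one]

/-- The approximation quality of `ξ` by an integer point of the conic, independent of `Σ`. -/
def ConicPts.quality {Φ : V3 → ℝ} (D : ℤ) (ξ : ℝ) (P : ConicPts Φ) : ℝ :=
  D * |P.ratio| / (|(P.1 1 : ℝ)| * |P.ratio - ξ|)

lemma lambdaPhi_eq_limsup_quality {A B C D : ℤ} (hC : 1 ≤ C) (hD : 1 ≤ D) {ξ : ℝ}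
    (hξ : Irrational ξ) {S : V3} (hS : ∀ c : ℝ, S ≠ c • XiOf A B C D ξ)
    (h : bil (Phi6 (-A) (-B) (-C) D 0 0) S (XiOf A B C D ξ) = 0) :
    lambdaPhi (Phi6 (-A) (-B) (-C) D 0 0) ((C : ℝ) * (D : ℝ) ^ 2) (XiOf A B C D ξ) S =
      limsup (fun P : ConicPts (Phi6 (-A) (-B) (-C) D 0 0) => ENNReal.ofReal (P.quality D ξ))
        (comap ConicPts.ratio (𝓝 ξ)) := by
  have hC' : (C : ℝ) ≠ 0 := by exact_mod_cast (by omega : C ≠ 0)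
  have hDpos : (0 : ℝ) < D := by exact_mod_cast (by omega : 0 < D)
  have hD' : (D : ℝ) ≠ 0 := hDpos.ne'
  rw [bil_XiOf] at h
  set k := leadCoeff A B D S with hk
  set g : ℝ → ℝ := fun r => k * r + (k * ξ - C * D * S 1) with hg
  have hfac : ∀ r, bil (Phi6 (-A) (-B) (-C) D 0 0) S (XiOf A B C D r) = (r - ξ) * g r := by
    intro r
    rw [bil_XiOf, hg]
    linear_combination h
  have hgξ : g ξ ≠ 0 := by
    intro h0
    rw [hg] at h0
    have h1 : C * D * S 1 = 2 * k * ξ := by linarith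
    have h2 : C * D * S 0 = 2 * k * ξ ^ 2 := by linear_combination 2 * h + 2 * ξ * h1
    have h3 : C * D * (D * S 2) = 2 * k * (A * ξ ^ 2 + B * ξ + C) := by
      have : C * (D * (D * S 2 - A * S 0 - B * S 1)) = C * (2 * k) := by rw [hk, leadCoeff]; ring
      linear_combination this + A * h2 + B * h1
    refine hS (2 * k / (C * D ^ 2)) (funext fun i => ?_)
    fin_cases i
    · simp only [XiOf, Pi.smul_apply, smul_eq_mul, Fin.zero_eta, Matrix.cons_val_zero]
      field_simp
      linear_combination h2
    · simp only [XiOf, Pi.smul_apply, smul_eq_mul, Fin.mk_one, Matrix.cons_val_one,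
        Matrix.cons_val_zero]
      field_simp
      linear_combination h1
    · simp only [XiOf, Pi.smul_apply, smul_eq_mul, Fin.reduceFinMk, Matrix.cons_val]
      field_simp
      linear_combination h3
  have hdisc : √((C : ℝ) * (D : ℝ) ^ 2 * |Phi6 (-A) (-B) (-C) D 0 0 S|) = |g ξ| :=
    sqrt_disc_mul_abs_phi S (by rw [hg]; linear_combination (-4 * k) * h) hC
  rw [lambdaPhi, dif_pos (XiOf_ne_zero hC hD ξ), comap_nhds_mk_XiOf hC hD hξ.ne_zero, hdisc]
  set l := comap (ConicPts.ratio (Φ := Phi6 (-A) (-B) (-C) D 0 0)) (𝓝 ξ)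
  have hr : Tendsto ConicPts.ratio l (𝓝 ξ) := tendsto_comap
  have hgc : Continuous g := by fun_prop
  have hρ : Tendsto (fun P : ConicPts (Phi6 (-A) (-B) (-C) D 0 0) =>
      ENNReal.ofReal (|g ξ| / |g P.ratio|)) l (𝓝 1) := by
    have : Tendsto (fun r => |g ξ| / |g r|) (𝓝 ξ) (𝓝 (|g ξ| / |g ξ|)) :=
      (continuousAt_const.div hgc.abs.continuousAt (abs_ne_zero.2 hgξ)).tendsto
    rw [div_self (abs_ne_zero.2 hgξ)] at this
    simpa using ENNReal.tendsto_ofReal (this.comp hr)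
  refine Eq.trans ?_ (limsup_mul_of_tendsto_one hρ)
  apply limsup_congr
  filter_upwards [hr.eventually_ne hξ.ne_zero] with P hP
  obtain ⟨h0, h1⟩ := ConicPts.coord_ne_zero hP
  rw [intCast3_eq_smul_XiOf hD h0 h1 P.2.2, bil_smul_right]
  change ENNReal.ofReal (|g ξ| / |_ * bil _ S (XiOf A B C D P.ratio)|) = _
  rw [hfac, ← ENNReal.ofReal_mul (by rw [ConicPts.quality]; positivity)]
  congr 1
  change |g ξ| / |(P.1 1 : ℝ) / (D * P.ratio) * _| = _
  rw [ConicPts.quality, abs_mul, abs_div, abs_mul, abs_mul, abs_of_pos hDpos]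
  have := abs_ne_zero.2 hP
  have : |(P.1 1 : ℝ)| ≠ 0 := abs_ne_zero.2 (by exact_mod_cast h1)
  field_simp

lemma ratio_and_quality {A B C D : ℤ} (hD : 1 ≤ D) {ξ : ℝ}
    {P : ConicPts (Phi6 (-A) (-B) (-C) D 0 0)} (hP : P.ratio ≠ 0) {m : ℤ × ℤ × ℤ}
    (ha : 0 < m.1) (hc : 0 < m.2.2) {x y k : ℤ}
    (h : ∀ i, m.1 * m.2.2 * P.1 i =
      k * conicParam A B C D (m.1 * x + m.2.1 * y) (m.2.2 * y) i) :
    y ≠ 0 ∧ (x : ℝ) / y = latticeCoord m P.ratio ∧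
      P.quality D ξ = 1 / ((y : ℝ) ^ 2 * |(x : ℝ) / y - latticeCoord m ξ|) / |(k : ℝ)| := by
  obtain ⟨hP0, hP1⟩ := ConicPts.coord_ne_zero hP
  have e0 := h 0
  have e1 := h 1
  simp only [conicParam, Matrix.cons_val_zero, Matrix.cons_val_one] at e0 e1
  set s := m.1 * x + m.2.1 * y with hs
  have hk : k ≠ 0 := by
    rintro rfl
    simp [ha.ne', hc.ne', hP0] at e0
  have hy : y ≠ 0 := by
    rintro rfl
    simp [ha.ne', hc.ne', hP1] at e1
  have hs0 : s ≠ 0 := by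
    intro hs0
    rw [hs0] at e0
    simp [ha.ne', hc.ne', hP0] at e0
  have haR : (0 : ℝ) < m.1 := by exact_mod_cast ha
  have hcR : (0 : ℝ) < m.2.2 := by exact_mod_cast hc
  have hyR : (y : ℝ) ≠ 0 := by exact_mod_cast hy
  have hsR : (s : ℝ) ≠ 0 := by exact_mod_cast hs0
  have hkR : (k : ℝ) ≠ 0 := by exact_mod_cast hk
  have hDR : (0 : ℝ) < D := by exact_mod_cast (by omega : 0 < D)
  have hP1R : (P.1 1 : ℝ) ≠ 0 := by exact_mod_cast hP1
  have e0' : (m.1 : ℝ) * m.2.2 * P.1 0 = k * (D * s ^ 2) := by exact_mod_cast e0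
  have e1' : (m.1 : ℝ) * m.2.2 * P.1 1 = k * (D * s * (m.2.2 * y)) := by exact_mod_cast e1
  have hsc : (s : ℝ) = m.1 * x + m.2.1 * y := by rw [hs]; push_cast; ring
  have hratio : P.ratio = s / (m.2.2 * y) := by
    rw [ConicPts.ratio, div_eq_div_iff hP1R (by positivity)]
    apply mul_left_cancel₀ (mul_pos haR hcR).ne'
    linear_combination m.2.2 * y * e0' - s * e1'
  have hcoord : (x : ℝ) / y = latticeCoord m P.ratio := by
    rw [hratio, latticeCoord, hsc]
    field_simp
    ring
  refine ⟨hy, hcoord, ?_⟩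
  rw [hcoord, latticeCoord_sub, ConicPts.quality]
  have hP1e : (P.1 1 : ℝ) = k * D * s * y / m.1 := by
    field_simp
    apply mul_left_cancel₀ hcR.ne'
    linear_combination e1'
  rw [← sq_abs (y : ℝ), hP1e, abs_mul, abs_div, abs_div, abs_mul, abs_mul, abs_mul, abs_of_pos haR,
    abs_of_pos hDR, abs_of_pos hcR]
  nth_rewrite 1 [hratio]
  rw [abs_div, abs_mul, abs_of_pos hcR]
  by_cases hz : |P.ratio - ξ| = 0
  · simp [hz]
  · have := abs_ne_zero.2 hsR
    have := abs_ne_zero.2 hkR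
    have := abs_ne_zero.2 hyR
    field_simp

lemma continuous_latticeCoord (m : ℤ × ℤ × ℤ) : Continuous (latticeCoord m) := by
  unfold latticeCoord
  fun_prop

lemma limsup_quality_le {A B C D : ℤ} (hC : 1 ≤ C) (hD : 1 ≤ D) {ξ : ℝ} (hξ : Irrational ξ) :
    limsup (fun P : ConicPts (Phi6 (-A) (-B) (-C) D 0 0) => ENNReal.ofReal (P.quality D ξ))
      (comap ConicPts.ratio (𝓝 ξ)) ≤
      ⨆ m ∈ adaptedLattices A B C D, lambdaCl (latticeCoord m ξ) := by
  refine le_of_forall_gt fun M hM => ?_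
  obtain ⟨M', hM', hMM'⟩ := exists_between hM
  refine lt_of_le_of_lt ?_ hMM'
  have hev : ∀ m ∈ adaptedLattices A B C D, ∀ᶠ r in 𝓝 ξ, ∀ q : ℚ, (q : ℝ) = latticeCoord m r →
      ENNReal.ofReal (1 / ((q.den : ℝ) ^ 2 * |(q : ℝ) - latticeCoord m ξ|)) < M' := by
    intro m hm
    have hlt : lambdaCl (latticeCoord m ξ) < M' := lt_of_le_of_lt
      (le_biSup (fun m => lambdaCl (latticeCoord m ξ)) hm) hM'
    have := eventually_lt_of_limsup_lt hlt
    rw [eventually_comap] at this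
    exact ((continuous_latticeCoord m).tendsto ξ).eventually this
  have hr : Tendsto (ConicPts.ratio (Φ := Phi6 (-A) (-B) (-C) D 0 0))
    (comap ConicPts.ratio (𝓝 ξ)) (𝓝 ξ) := tendsto_comap
  refine limsup_le_of_le (by isBoundedDefault) ?_
  filter_upwards [hr.eventually ((Filter.eventually_all_finset _).2 hev),
    hr.eventually_ne hξ.ne_zero] with P hP hP0
  have hPne : P.1 ≠ 0 := fun h => P.2.1 (intCast3_eq_zero.2 h)
  obtain ⟨m, hm, x, y, k, hk, h⟩ :=
    exists_adapted_param hC hD hPne (phi_intCast3_eq_zero_iff.1 P.2.2)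
  obtain ⟨ha, hc⟩ := pos_of_mem_adaptedLattices hm
  obtain ⟨hy, hxy, hq⟩ := ratio_and_quality (ξ := ξ) hD hP0 ha hc h
  have hqc : (((x : ℚ) / y : ℚ) : ℝ) = (x : ℝ) / y := by push_cast; rfl
  refine le_trans ?_ (hP m hm ((x : ℚ) / y) (hqc.trans hxy)).le
  apply ENNReal.ofReal_le_ofReal
  rw [hq, hqc]
  have hk1 : (1 : ℝ) ≤ |(k : ℝ)| := by exact_mod_cast Int.one_le_abs hk
  refine (div_le_self (by positivity) hk1).trans ?_
  have hne : (x : ℝ) / y - latticeCoord m ξ ≠ 0 := by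
    intro h0
    refine irrational_latticeCoord ha hc hξ ⟨(x : ℚ) / y, ?_⟩
    rw [hqc]
    linarith
  have hden : (((x : ℚ) / y : ℚ).den : ℝ) ^ 2 ≤ (y : ℝ) ^ 2 := by
    rw [sq_le_sq, Nat.abs_cast]
    have hdvd : ((((x : ℚ) / y : ℚ).den : ℕ) : ℤ) ∣ y := by
      rw [← Rat.divInt_eq_div]
      exact Rat.den_dvd x y
    have := Int.le_of_dvd (abs_pos.2 hy) ((dvd_abs _ _).2 hdvd)
    exact_mod_cast this
  have hdpos : (0 : ℝ) < ((x : ℚ) / y : ℚ).den := by exact_mod_cast Rat.den_pos _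
  have := abs_pos.2 hne
  gcongr

lemma le_limsup_quality {A B C D : ℤ} (hC : 1 ≤ C) (hD : 1 ≤ D) {ξ : ℝ} (hξ : Irrational ξ)
    {m : ℤ × ℤ × ℤ} (hm : m ∈ adaptedLattices A B C D) :
    lambdaCl (latticeCoord m ξ) ≤
    limsup (fun P : ConicPts (Phi6 (-A) (-B) (-C) D 0 0) => ENNReal.ofReal (P.quality D ξ))
      (comap ConicPts.ratio (𝓝 ξ)) := by
  obtain ⟨ha, hc⟩ := pos_of_mem_adaptedLattices hm
  have had := isAdapted_of_mem_adaptedLattices hm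
  have haR : (m.1 : ℝ) ≠ 0 := by exact_mod_cast ha.ne'
  have hcR : (m.2.2 : ℝ) ≠ 0 := by exact_mod_cast hc.ne'
  let ι : ℚ → ConicPts (Phi6 (-A) (-B) (-C) D 0 0) := fun q =>
    ⟨adaptedPoint A B C D m.1 m.2.1 m.2.2 q.num q.den,
      adaptedPoint_mem_conic hC hD ha hc had (Or.inr (by exact_mod_cast q.den_ne_zero))⟩
  have hι : ∀ q i, m.1 * m.2.2 * (ι q).1 i =
      1 * conicParam A B C D (m.1 * q.num + m.2.1 * q.den) (m.2.2 * q.den) i :=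
    fun q i => by rw [one_mul]; exact mul_adaptedPoint had _ _ i
  let σ : ℝ → ℝ := fun z => (m.1 * z + m.2.1) / m.2.2
  have hσc : Continuous σ := by fun_prop
  have hσξ : σ (latticeCoord m ξ) = ξ := by
    simp only [σ, latticeCoord]
    field_simp
    ring
  have hσ : Tendsto (fun q : ℚ => σ q) (comap (fun q : ℚ => (q : ℝ)) (𝓝 (latticeCoord m ξ)))
      (𝓝 ξ) := by
    have := hσc.tendsto (latticeCoord m ξ)
    rw [hσξ] at this
    exact this.comp tendsto_comap
  have hratio : ∀ q : ℚ, σ q ≠ 0 → (ι q).ratio = σ q := by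
    intro q hq
    have hdR : (q.den : ℝ) ≠ 0 := by exact_mod_cast q.den_ne_zero
    have hqe : (q : ℝ) * q.den = q.num := by exact_mod_cast Rat.mul_den_eq_num q
    have e0 := hι q 0
    have e1 := hι q 1
    simp only [conicParam, Matrix.cons_val_zero, Matrix.cons_val_one, one_mul] at e0 e1
    have e0' : (m.1 : ℝ) * m.2.2 * (ι q).1 0 = D * (m.1 * q.num + m.2.1 * q.den) ^ 2 := by
      exact_mod_cast e0
    have e1' : (m.1 : ℝ) * m.2.2 * (ι q).1 1 =
        D * (m.1 * q.num + m.2.1 * q.den) * (m.2.2 * q.den) := by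
      exact_mod_cast e1
    have hDR : (D : ℝ) ≠ 0 := by exact_mod_cast (by omega : D ≠ 0)
    have hse : (m.1 : ℝ) * q.num + m.2.1 * q.den = m.2.2 * q.den * σ q := by
      simp only [σ]
      field_simp
      linear_combination (-m.1 : ℝ) * hqe
    rw [hse] at e0' e1'
    have h1 : ((ι q).1 1 : ℝ) ≠ 0 := by
      intro h
      rw [h, mul_zero] at e1'
      exact (mul_ne_zero (mul_ne_zero hDR (mul_ne_zero (mul_ne_zero hcR hdR) hq))
        (mul_ne_zero hcR hdR)) e1'.symm
    rw [ConicPts.ratio, div_eq_iff h1]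
    apply mul_left_cancel₀ (mul_ne_zero haR hcR)
    linear_combination e0' - σ q * e1'
  have hne := hσ.eventually_ne hξ.ne_zero
  have hιt : Tendsto ι (comap (fun q : ℚ => (q : ℝ)) (𝓝 (latticeCoord m ξ)))
      (comap ConicPts.ratio (𝓝 ξ)) := by
    rw [tendsto_comap_iff]
    refine hσ.congr' ?_
    filter_upwards [hne] with q hq
    exact (hratio q hq).symm
  refine le_trans (le_of_eq ?_) (limsup_le_limsup_of_le hιt)
  rw [lambdaCl, ← Filter.limsup_comp]
  apply limsup_congr
  filter_upwards [hne] with q hq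
  obtain ⟨-, -, h⟩ := ratio_and_quality (ξ := ξ) hD (by rwa [hratio q hq]) ha hc (hι q)
  rw [Function.comp_apply, h]
  simp only [Int.cast_natCast, Int.cast_one, abs_one, div_one]
  rw [← Rat.cast_def]

lemma exists_lambdaPhi_eq_lambdaCl {A B C D : ℤ} (hC : 1 ≤ C) (hD : 1 ≤ D) {ξ : ℝ}
    (hξ : Irrational ξ) {S : V3} (hS : ∀ c : ℝ, S ≠ c • XiOf A B C D ξ)
    (h : bil (Phi6 (-A) (-B) (-C) D 0 0) S (XiOf A B C D ξ) = 0) :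
    ∃ η : ℝ, Irrational η ∧
      lambdaPhi (Phi6 (-A) (-B) (-C) D 0 0) ((C : ℝ) * (D : ℝ) ^ 2) (XiOf A B C D ξ) S =
        lambdaCl η := by
  obtain ⟨m, hm, hmax⟩ := Finset.exists_mem_eq_sup _ (adaptedLattices_nonempty hC hD)
    fun m => lambdaCl (latticeCoord m ξ)
  obtain ⟨ha, hc⟩ := pos_of_mem_adaptedLattices hm
  refine ⟨_, irrational_latticeCoord ha hc hξ, ?_⟩
  rw [lambdaPhi_eq_limsup_quality hC hD hξ hS h]
  apply le_antisymm
  · rw [← hmax, Finset.sup_eq_iSup]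
    exact limsup_quality_le hC hD hξ
  · exact le_limsup_quality hC hD hξ hm

/-- Corollary 5.1(a): every Lagrange approximability of a point of the
conic `Φ_{A,B,C,D} = 0` is the classical approximability of some irrational real, and every
Markoff approximability of a pair is the classical Markoff approximability of some pair of
distinct irrationals; in particular the Lagrange and Markoff spectra of the conic are
contained in the classical ones. -/
theorem stmt15 (A B C D : ℤ) (hC : 1 ≤ C) (hD : 1 ≤ D) :
    (∀ ξ : ℝ, Irrational ξ → ∀ Sg : V3,
      bil (Phi6 (-A) (-B) (-C) D 0 0) Sg (XiOf A B C D ξ) = 0 →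
      (∀ c : ℝ, Sg ≠ c • XiOf A B C D ξ) →
      ∃ η : ℝ, Irrational η ∧
        lambdaPhi (Phi6 (-A) (-B) (-C) D 0 0) ((C : ℝ) * (D : ℝ) ^ 2) (XiOf A B C D ξ) Sg =
          lambdaCl η) ∧
    (∀ ξ ξ' : ℝ, Irrational ξ → Irrational ξ' → ξ ≠ ξ' → ∀ Sg : V3, Sg ≠ 0 →
      bil (Phi6 (-A) (-B) (-C) D 0 0) Sg (XiOf A B C D ξ) = 0 →
      bil (Phi6 (-A) (-B) (-C) D 0 0) Sg (XiOf A B C D ξ') = 0 →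
      ∃ η η' : ℝ, Irrational η ∧ Irrational η' ∧ η ≠ η' ∧
        muPhi (Phi6 (-A) (-B) (-C) D 0 0) ((C : ℝ) * (D : ℝ) ^ 2) Sg = muCl η η') := by
  exact ⟨fun ξ hξ Sg h hS => exists_lambdaPhi_eq_lambdaCl hC hD hξ hS h,
    fun ξ ξ' hξ hξ' hne Sg hS h h' => exists_muPhi_eq_muCl hC hD hξ hξ' hne hS h h'⟩

end
end

section
/- Let A, B, C, D be integers with C ≥ 1 and D ≥ 1, and let R = R_{A,B,C,D} ⊆ Mat₂(ℤ). Then there exist positive integers m and n with n·m² dividing C·D², and a ℚ-basis (v₁, v₂) of ℚ², such that, setting Λ₀ = ℤ·v₁ + ℤ·v₂ and Λ_d = ℤ·(d·v₁) + ℤ·v₂ for each positive divisor d of n, the following holds: for every full-rank ℤ-submodule Λ ⊆ Λ₀ with Λ ⊄ p·Λ₀ for every prime p, one has M·Λ ⊆ Λ for all M ∈ R if and only if there exists a positive divisor d of n with Λ ⊆ Λ_d and the index [Λ_d : Λ] dividing m. -/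
noncomputable section

/-- A basis `v₁, v₂` in which each operator `X i` has the integral matrix with off-diagonal
entries `m * c i`, `m * b i` and diagonal difference `m * e i`, where the coefficient
determinant scaled by `m ^ 3` is `Δ`. -/
structure IsFrame {V : Type*} [AddCommGroup V] [Module ℚ V] (X : Fin 3 → V →ₗ[ℚ] V) (Δ m : ℤ)
    (v₁ v₂ : V) (c e b : Fin 3 → ℤ) : Prop where
  linearIndependent : LinearIndependent ℚ ![v₁, v₂]
  action : ∀ i, ∃ a d : ℤ, X i v₁ = a • v₁ + (m * c i) • v₂ ∧
    X i v₂ = (m * b i) • v₁ + d • v₂ ∧ a - d = m * e i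
  disc : m ^ 3 * (Matrix.of ![c, e, b]).det = Δ

namespace IsFrame

variable {V : Type*} [AddCommGroup V] [Module ℚ V] {X : Fin 3 → V →ₗ[ℚ] V} {Δ m : ℤ}
  {v₁ v₂ : V} {c e b : Fin 3 → ℤ}

theorem shear_left (h : IsFrame X Δ m v₁ v₂ c e b) (τ : ℤ) :
    IsFrame X Δ m (v₁ + τ • v₂) v₂ (fun i => c i - τ * e i - τ ^ 2 * b i)
      (fun i => e i + 2 * τ * b i) b where
  linearIndependent := by
    have hl := LinearIndependent.pair_iff.1 h.linearIndependent
    refine LinearIndependent.pair_iff.2 fun x y hxy => ?_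
    obtain ⟨h1, h2⟩ := hl x (x * τ + y) (by rw [← hxy]; module)
    subst h1
    exact ⟨rfl, by simpa using h2⟩
  action i := by
    obtain ⟨a, d, h1, h2, h3⟩ := h.action i
    obtain rfl : d = a - m * e i := by linarith
    refine ⟨a + τ * (m * b i), a - m * e i - τ * (m * b i), ?_, ?_, by ring⟩
    · rw [map_add, map_zsmul, h1, h2]; module
    · rw [h2]; module
  disc := by
    rw [← h.disc]; simp [Matrix.det_fin_three, -mul_eq_mul_left_iff]; ring

theorem shear_right (h : IsFrame X Δ m v₁ v₂ c e b) (τ : ℤ) :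
    IsFrame X Δ m v₁ (v₂ + τ • v₁) c (fun i => e i - 2 * τ * c i)
      (fun i => b i + τ * e i - τ ^ 2 * c i) where
  linearIndependent := by
    have hl := LinearIndependent.pair_iff.1 h.linearIndependent
    refine LinearIndependent.pair_iff.2 fun x y hxy => ?_
    obtain ⟨h1, h2⟩ := hl (x + y * τ) y (by rw [← hxy]; module)
    subst h2
    exact ⟨by simpa using h1, rfl⟩
  action i := by
    obtain ⟨a, d, h1, h2, h3⟩ := h.action i
    obtain rfl : d = a - m * e i := by linarith
    refine ⟨a - τ * (m * c i), a - m * e i + τ * (m * c i), ?_, ?_, by ring⟩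
    · rw [h1]; module
    · rw [map_add, map_zsmul, h1, h2]; module
  disc := by
    rw [← h.disc]; simp [Matrix.det_fin_three, -mul_eq_mul_left_iff]; ring

theorem scale_left {k : ℤ} (hk : k ≠ 0) (h : IsFrame X Δ m v₁ v₂ c e (fun i => k * b i)) :
    IsFrame X Δ m (k • v₁) v₂ (fun i => k * c i) e b where
  linearIndependent := by
    have hl := LinearIndependent.pair_iff.1 h.linearIndependent
    refine LinearIndependent.pair_iff.2 fun x y hxy => ?_
    obtain ⟨h1, h2⟩ := hl (x * k) y (by rw [← hxy]; module)
    exact ⟨by simpa [hk] using h1, h2⟩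
  action i := by
    obtain ⟨a, d, h1, h2, h3⟩ := h.action i
    refine ⟨a, d, ?_, ?_, h3⟩
    · rw [map_zsmul, h1]; module
    · rw [h2]; module
  disc := by
    rw [← h.disc]; simp [Matrix.det_fin_three, -mul_eq_mul_left_iff]; ring

theorem scale_right {k : ℤ} (hk : k ≠ 0) (h : IsFrame X Δ m v₁ v₂ (fun i => k * c i) e b) :
    IsFrame X Δ m v₁ (k • v₂) c e (fun i => k * b i) where
  linearIndependent := by
    have hl := LinearIndependent.pair_iff.1 h.linearIndependent
    refine LinearIndependent.pair_iff.2 fun x y hxy => ?_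
    obtain ⟨h1, h2⟩ := hl x (y * k) (by rw [← hxy]; module)
    exact ⟨h1, by simpa [hk] using h2⟩
  action i := by
    obtain ⟨a, d, h1, h2, h3⟩ := h.action i
    refine ⟨a, d, ?_, ?_, h3⟩
    · rw [h1]; module
    · rw [map_zsmul, h2]; module
  disc := by
    rw [← h.disc]; simp [Matrix.det_fin_three, -mul_eq_mul_left_iff]; ring

theorem absorb_content {k : ℤ}
    (h : IsFrame X Δ m v₁ v₂ (fun i => k * c i) (fun i => k * e i) (fun i => k * b i)) :
    IsFrame X Δ (k * m) v₁ v₂ c e b where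
  linearIndependent := h.linearIndependent
  action i := by
    obtain ⟨a, d, h1, h2, h3⟩ := h.action i
    refine ⟨a, d, ?_, ?_, by rw [h3]; ring⟩
    · rw [h1]; module
    · rw [h2]; module
  disc := by
    rw [← h.disc]; simp [Matrix.det_fin_three, -mul_eq_mul_left_iff]; ring

theorem mul_pow_dvd {n : ℤ} (h : IsFrame X Δ m v₁ v₂ c e b) (hn : ∀ i, n ∣ b i) :
    n * m ^ 3 ∣ Δ := by
  choose b' hb using hn
  obtain rfl : b = fun i => n * b' i := funext hb
  rw [← h.disc]
  refine ⟨(Matrix.of ![c, e, b']).det, ?_⟩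
  simp [Matrix.det_fin_three, -mul_eq_mul_left_iff]; ring

theorem dvd_of_maximal {n : ℕ} (h : IsFrame X Δ m v₁ v₂ c e b) (hn : ∀ i, (n : ℤ) ∣ b i)
    (hn0 : n ≠ 0)
    (hm_max : ∀ p : ℕ, p.Prime → ∀ v₁ v₂ c e b, ¬ IsFrame X Δ (p * m) v₁ v₂ c e b)
    (hn_max : ∀ p : ℕ, p.Prime → ∀ v₁ v₂ c e b, IsFrame X Δ m v₁ v₂ c e b →
      ¬ ∀ i, ((p * n : ℕ) : ℤ) ∣ b i)
    {M : ℕ} {s t : ℤ} (hst : IsCoprime s t)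
    (hM : ∀ i, (M : ℤ) ∣ c i * t ^ 2 + e i * (s * t) - b i * s ^ 2) :
    M ∣ n ∧ (M : ℤ) ∣ t := by
  have key : ∀ p k : ℕ, p.Prime → p ^ k ∣ M → p ^ k ∣ n ∧ p ^ k ∣ t.natAbs := by
    intro p k hp hpk
    rcases Nat.eq_zero_or_pos k with rfl | hk
    · simp
    have hpZ : Prime (p : ℤ) := Nat.prime_iff_prime_int.1 hp
    have hp0 : (p : ℤ) ≠ 0 := hpZ.ne_zero
    have hQ : ∀ i, (p : ℤ) ^ k ∣ c i * t ^ 2 + e i * (s * t) - b i * s ^ 2 := fun i =>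
      dvd_trans (by exact_mod_cast hpk) (hM i)
    have hQ1 : ∀ i, (p : ℤ) ∣ c i * t ^ 2 + e i * (s * t) - b i * s ^ 2 := fun i =>
      dvd_trans (dvd_pow_self _ hk.ne') (hQ i)
    have hpt : (p : ℤ) ∣ t := by
      by_contra hpt
      obtain ⟨u, w, huw⟩ := (hpZ.coprime_iff_not_dvd.2 hpt)
      have hc : ∀ i, (p : ℤ) ∣ c i - (-(s * w)) * e i - (-(s * w)) ^ 2 * b i := by
        intro i
        have : c i - (-(s * w)) * e i - (-(s * w)) ^ 2 * b i =
            w ^ 2 * (c i * t ^ 2 + e i * (s * t) - b i * s ^ 2)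
              + p * (u * (1 + w * t) * c i + u * s * w * e i) := by
          have h1 : w * t = 1 - u * p := by linarith
          linear_combination (- c i * (w * t + 1) - e i * s * w) * huw
        rw [this]
        exact dvd_add (dvd_mul_of_dvd_right (hQ1 i) _) (dvd_mul_right _ _)
      choose c' hc' using hc
      have h1 := h.shear_left (-(s * w))
      rw [funext hc'] at h1
      refine hn_max p hp _ _ _ _ _ (h1.scale_right hp0) fun i => ?_
      push_cast
      exact mul_dvd_mul_left _ (hn i)
    have hps : ¬ (p : ℤ) ∣ s := fun hps => hpZ.not_isUnit (hst.isUnit_of_dvd' hps hpt)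
    obtain ⟨j, n', hpn', hnj⟩ := Nat.exists_eq_pow_mul_and_not_dvd hn0 p hp.ne_one
    have hn'Z : ¬ (p : ℤ) ∣ n' := by exact_mod_cast hpn'
    have hdivt : ∀ i : ℕ, i ≤ j → i ≤ k → (p : ℤ) ^ i ∣ t := by
      intro i
      induction i with
      | zero => simp
      | succ i ih =>
        intro hij hik
        rcases Nat.eq_zero_or_pos i with rfl | hi
        · simpa using hpt
        obtain ⟨t', rfl⟩ := ih (by omega) (by omega)
        by_contra hnd
        have ht' : ¬ (p : ℤ) ∣ t' := fun ⟨r, hr⟩ => hnd ⟨r, by rw [hr]; ring⟩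
        have hb : ∀ l, ∃ r, b l = (p : ℤ) ^ i * (p * r) := by
          intro l
          obtain ⟨r, hr⟩ := hn l
          obtain ⟨q, rfl⟩ := Nat.exists_eq_add_of_le hij
          refine ⟨p ^ q * n' * r, ?_⟩
          rw [hr, hnj]; push_cast; ring
        choose b' hb' using hb
        have he : ∀ l, ∃ r, e l = p * r := by
          intro l
          have h1 : (p : ℤ) ^ (i + 1) ∣ p ^ i * (e l * (s * t')) := by
            have h2 := dvd_trans (pow_dvd_pow (p : ℤ) hik) (hQ l)
            have h3 : (p : ℤ) ^ (i + 1) ∣ c l * (p ^ i * t') ^ 2 := by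
              obtain ⟨q, rfl⟩ := Nat.exists_eq_add_of_lt hi
              exact ⟨c l * p ^ q * t' ^ 2, by ring⟩
            have h4 : (p : ℤ) ^ (i + 1) ∣ b l * s ^ 2 := ⟨b' l * s ^ 2, by rw [hb' l]; ring⟩
            exact ((h2.sub h3).add h4).trans (dvd_of_eq (by ring))
          rw [pow_succ] at h1
          have h2 := Int.dvd_of_mul_dvd_mul_left (pow_ne_zero i hp0) h1
          rcases hpZ.dvd_or_dvd h2 with h3 | h3
          · exact h3
          · exact absurd h3 (fun h3 => (hpZ.dvd_or_dvd h3).elim hps ht')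
        choose e' he' using he
        rw [funext hb', funext he'] at h
        have h1 := h.scale_left (pow_ne_zero i hp0)
        obtain ⟨q, rfl⟩ := Nat.exists_eq_add_of_lt hi
        have h2 : (fun l => (p : ℤ) ^ (0 + q + 1) * c l) = fun l => p * (p ^ q * c l) := by
          funext l; ring
        rw [h2] at h1
        exact hm_max p hp _ _ _ _ _ h1.absorb_content
    have hkj : k ≤ j := by
      by_contra! hjk
      obtain ⟨t', rfl⟩ := hdivt j le_rfl hjk.le
      have hcop : ¬ (p : ℤ) ∣ s * n' := fun h3 => (hpZ.dvd_or_dvd h3).elim hps hn'Z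
      obtain ⟨u, w, huw⟩ := (hpZ.coprime_iff_not_dvd.2 hcop)
      choose b' hb' using hn
      rcases Nat.eq_zero_or_pos j with rfl | hj
      · refine hn_max p hp _ _ _ _ _ h fun l => ?_
        have h1 : (p : ℤ) ∣ b l * s ^ 2 := by
          have h2 : (p : ℤ) ∣ c l * (p ^ 0 * t') ^ 2 + e l * (s * (p ^ 0 * t')) := by
            obtain ⟨r, hr⟩ := hpt
            rw [hr]
            exact ⟨c l * p * r ^ 2 + e l * s * r, by ring⟩
          have h3 := h2.sub (hQ1 l)
          rwa [sub_sub_cancel] at h3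
        have h2 : (p : ℤ) ∣ b l :=
          (hpZ.dvd_or_dvd h1).resolve_right fun h3 => hps (hpZ.dvd_of_dvd_pow h3)
        have h3 : IsCoprime (p : ℤ) n := by
          rw [hnj]; simpa using hpZ.coprime_iff_not_dvd.2 hn'Z
        push_cast
        exact h3.mul_dvd h2 ⟨_, hb' l⟩
      · refine hn_max p hp _ _ _ _ _ (h.shear_right (-(n * (w * t')))) fun l => ?_
        obtain ⟨q, rfl⟩ := Nat.exists_eq_add_of_lt hj
        have h1 : (p : ℤ) ∣ e l * t' - n' * b' l * s := by
          have h2 := dvd_trans (pow_dvd_pow (p : ℤ) (Nat.succ_le_of_lt hjk)) (hQ l)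
          have h3 : (p : ℤ) ^ (0 + q + 1 + 1) ∣ c l * (p ^ (0 + q + 1) * t') ^ 2 :=
            ⟨c l * p ^ q * t' ^ 2, by ring⟩
          have h4 : (p : ℤ) ^ (0 + q + 1) * p ∣ p ^ (0 + q + 1) * (s * (e l * t' - n' * b' l * s)) := by
            rw [← pow_succ]
            have h5 := h2.sub h3
            rw [hb' l, hnj] at h5
            push_cast at h5
            exact h5.trans (dvd_of_eq (by ring))
          have h5 := Int.dvd_of_mul_dvd_mul_left (pow_ne_zero _ hp0) h4
          exact (hpZ.dvd_or_dvd h5).resolve_left hps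
        have h2 : (p : ℤ) ∣ b' l - w * t' * e l - n * w ^ 2 * t' ^ 2 * c l := by
          have h3 : b' l - w * t' * e l - n * w ^ 2 * t' ^ 2 * c l =
              p * (u * b' l) - w * (e l * t' - n' * b' l * s)
                - p * (p ^ q * n' * w ^ 2 * t' ^ 2 * c l) := by
            rw [hnj]; push_cast
            linear_combination (-b' l) * huw
          rw [h3]
          exact ((dvd_mul_right _ _).sub (h1.mul_left _)).sub (dvd_mul_right _ _)
        obtain ⟨r, hr⟩ := h2
        refine ⟨r, ?_⟩
        push_cast
        rw [hb' l]
        linear_combination (n : ℤ) * hr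
    refine ⟨?_, ?_⟩
    · rw [hnj]; exact dvd_mul_of_dvd_left (pow_dvd_pow p hkj) _
    · have := Int.natAbs_dvd_natAbs.2 (hdivt k hkj le_rfl)
      simpa [Int.natAbs_pow] using this
  refine ⟨?_, Int.natCast_dvd.2 ?_⟩
  · exact (Nat.dvd_iff_prime_pow_dvd_dvd _ _).2 fun p k hp h => (key p k hp h).1
  · exact (Nat.dvd_iff_prime_pow_dvd_dvd _ _).2 fun p k hp h => (key p k hp h).2

theorem invariant_iff (h : IsFrame X Δ m v₁ v₂ c e b) {Λ : Submodule ℤ V}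
    (hΛ : Λ ≤ Submodule.span ℤ {v₁, v₂}) {M s t : ℤ} (hst : IsCoprime s t)
    (hmem : ∀ x y : ℤ, x • v₁ + y • v₂ ∈ Λ ↔ M ∣ s * x + t * y) :
    (∀ i, ∀ v ∈ Λ, X i v ∈ Λ) ↔
      ∀ i, M ∣ m * (c i * t ^ 2 + e i * (s * t) - b i * s ^ 2) := by
  refine forall_congr' fun i => ?_
  obtain ⟨a, d, h1, h2, h3⟩ := h.action i
  have hX : ∀ x y : ℤ, X i (x • v₁ + y • v₂) =
      (a * x + m * b i * y) • v₁ + (m * c i * x + d * y) • v₂ := by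
    intro x y
    rw [map_add, map_zsmul, map_zsmul, h1, h2]; module
  constructor
  · intro hinv
    have h4 := hinv _ ((hmem t (-s)).2 ⟨0, by ring⟩)
    rw [hX, hmem] at h4
    refine h4.trans (dvd_of_eq ?_)
    linear_combination s * t * h3
  · intro hQ v hv
    obtain ⟨x, y, rfl⟩ := Submodule.mem_span_pair.1 (hΛ hv)
    obtain ⟨α, β, hαβ⟩ := hst
    obtain ⟨q, hq⟩ := hQ
    obtain ⟨r, hr⟩ := (hmem x y).1 hv
    rw [hX, hmem]
    refine ⟨(α * (s * a + t * m * c i) + β * (s * m * b i + t * d)) * r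
      + (β * x - α * y) * q, ?_⟩
    linear_combination
      (α * (s * a + t * m * c i) + β * (s * m * b i + t * d)) * hr + (β * x - α * y) * hq
      - ((s * a + t * m * c i) * x + (s * m * b i + t * d) * y) * hαβ
      + (β * x - α * y) * s * t * h3

theorem mem_span_smul_iff (h : IsFrame X Δ m v₁ v₂ c e b) (d x y : ℤ) :
    x • v₁ + y • v₂ ∈ Submodule.span ℤ {d • v₁, v₂} ↔ d ∣ x := by
  rw [Submodule.mem_span_pair]
  constructor
  · rintro ⟨z, w, hzw⟩
    have h1 := (LinearIndependent.pair_iff.1 h.linearIndependent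
      ((x - z * d : ℤ) : ℚ) ((y - w : ℤ) : ℚ) (by
        rw [Int.cast_smul_eq_zsmul, Int.cast_smul_eq_zsmul]
        rw [← sub_eq_zero] at hzw
        rw [← neg_eq_zero, ← hzw]
        module)).1
    exact ⟨z, by have := Int.cast_eq_zero.1 h1; linarith⟩
  · rintro ⟨z, rfl⟩
    exact ⟨z, y, by module⟩

end IsFrame

theorem exists_congruence (L : Submodule ℤ (Fin 2 → ℤ)) (hL : L.toAddSubgroup.index ≠ 0)
    (hprim : ∀ p : ℕ, p.Prime → ∃ v ∈ L, ∀ w : Fin 2 → ℤ, v ≠ (p : ℤ) • w) :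
    ∃ (M : ℕ) (s t : ℤ), 0 < M ∧ IsCoprime s t ∧
      ∀ v, v ∈ L ↔ (M : ℤ) ∣ s * v 0 + t * v 1 := by
  obtain ⟨φ⟩ := Int.submodule_toAddSubgroup_index_ne_zero_iff.1 hL
  obtain ⟨f, a, g, hfg⟩ := Submodule.exists_smith_normal_form_of_rank_eq
    (Pi.basisFun ℤ (Fin 2)) (N := L) φ.finrank_eq
  have hmem : ∀ v, v ∈ L ↔ ∀ i, a i ∣ f.repr v i := by
    intro v
    constructor
    · intro hv i
      have h1 := congrArg (Subtype.val) (g.sum_repr ⟨v, hv⟩)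
      simp only [Fin.sum_univ_two, Submodule.coe_add, Submodule.coe_smul, hfg] at h1
      rw [← h1]
      fin_cases i <;> simp [-zsmul_eq_mul]
    · intro h
      choose r hr using h
      rw [← f.sum_repr v]
      refine Submodule.sum_mem _ fun i _ => ?_
      rw [hr, mul_comm, mul_smul, ← hfg]
      exact L.smul_mem _ (g i).2
  have ha0 : ∀ i, a i ≠ 0 := by
    intro i hi
    have := hfg i
    rw [hi, zero_smul] at this
    exact g.ne_zero i (Subtype.ext this)
  have hcop : IsCoprime (a 0) (a 1) := by
    rw [Int.isCoprime_iff_gcd_eq_one]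
    by_contra hg
    obtain ⟨p, hp, hpg⟩ := Nat.exists_prime_and_dvd hg
    obtain ⟨v, hv, hvp⟩ := hprim p hp
    have hpa : ∀ i, (p : ℤ) ∣ a i := by
      have h0 := (Int.natCast_dvd_natCast.2 hpg).trans (Int.gcd_dvd_left (a 0) (a 1))
      have h1 := (Int.natCast_dvd_natCast.2 hpg).trans (Int.gcd_dvd_right (a 0) (a 1))
      intro i
      fin_cases i
      · exact h0
      · exact h1
    choose r hr using fun i => (hpa i).trans ((hmem v).1 hv i)
    refine hvp (∑ i, r i • f i) ?_
    rw [← f.sum_repr v, Finset.smul_sum]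
    exact Finset.sum_congr rfl fun i _ => by rw [hr, mul_smul]
  set P : Fin 2 → Fin 2 → ℤ := fun j => f.repr (Pi.single j 1) with hP
  have hrepr : ∀ v i, f.repr v i = v 0 * P 0 i + v 1 * P 1 i := by
    intro v i
    have : v = v 0 • Pi.single 0 1 + v 1 • Pi.single 1 1 := by
      ext j; fin_cases j <;> simp
    conv_lhs => rw [this]
    simp [hP, -zsmul_eq_mul]
  refine ⟨(a 0 * a 1).natAbs, a 1 * P 0 0 + a 0 * P 0 1, a 1 * P 1 0 + a 0 * P 1 1,
    Int.natAbs_pos.2 (mul_ne_zero (ha0 0) (ha0 1)), ?_, ?_⟩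
  · obtain ⟨x, y, hxy⟩ := hcop
    have h0 := hrepr (f 0)
    have h1 := hrepr (f 1)
    have h00 := h0 0
    have h01 := h0 1
    have h10 := h1 0
    have h11 := h1 1
    simp at h00 h01 h10 h11
    refine ⟨y * f 0 0 + x * f 1 0, y * f 0 1 + x * f 1 1, ?_⟩
    linear_combination hxy - y * a 1 * h00 - y * a 0 * h01 - x * a 1 * h10 - x * a 0 * h11
  · intro v
    have h1 : (a 1 * P 0 0 + a 0 * P 0 1) * v 0 + (a 1 * P 1 0 + a 0 * P 1 1) * v 1 =
        a 1 * f.repr v 0 + a 0 * f.repr v 1 := by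
      rw [hrepr, hrepr]; ring
    rw [hmem, Fin.forall_fin_two, h1, Int.natAbs_dvd]
    constructor
    · rintro ⟨⟨x, hx⟩, ⟨y, hy⟩⟩
      exact ⟨x + y, by rw [hx, hy]; ring⟩
    · intro h
      constructor
      · refine hcop.dvd_of_dvd_mul_left ?_
        exact (dvd_add_left (dvd_mul_right _ _)).1 ((dvd_mul_right _ _).trans h)
      · refine hcop.symm.dvd_of_dvd_mul_left ?_
        exact (dvd_add_right (dvd_mul_right _ _)).1 ((dvd_mul_left _ _).trans h)

theorem index_of_congruence (L : AddSubgroup (Fin 2 → ℤ)) {M : ℕ} {s t : ℤ} (hM : 0 < M)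
    (hst : IsCoprime s t) (hL : ∀ v, v ∈ L ↔ (M : ℤ) ∣ s * v 0 + t * v 1) : L.index = M := by
  have : NeZero M := ⟨hM.ne'⟩
  let φ : (Fin 2 → ℤ) →+ ZMod M :=
    { toFun v := ((s * v 0 + t * v 1 : ℤ) : ZMod M)
      map_zero' := by simp
      map_add' v w := by push_cast [Pi.add_apply]; ring }
  have hker : φ.ker = L := by
    ext v
    rw [AddMonoidHom.mem_ker, hL, ← ZMod.intCast_zmod_eq_zero_iff_dvd]
    rfl
  have hsurj : Function.Surjective φ := by
    intro z
    obtain ⟨x, y, hxy⟩ := hst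
    obtain ⟨z, rfl⟩ := ZMod.intCast_surjective z
    refine ⟨![z * x, z * y], congrArg Int.cast ?_⟩
    simp only [Matrix.cons_val_zero, Matrix.cons_val_one]
    linear_combination z * hxy
  rw [← hker, AddSubgroup.index_ker, AddMonoidHom.range_eq_top.2 hsurj]
  simp

theorem relIndex_span_pair_eq_index {V : Type*} [AddCommGroup V] (v₁ v₂ : V)
    (Λ : Submodule ℤ V) :
    Λ.toAddSubgroup.relIndex (Submodule.span ℤ {v₁, v₂}).toAddSubgroup =
      (Λ.comap (Fintype.linearCombination ℤ ![v₁, v₂])).toAddSubgroup.index := by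
  let φ := (Fintype.linearCombination ℤ ![v₁, v₂]).toAddMonoidHom
  have hφ : AddSubgroup.map φ ⊤ = (Submodule.span ℤ {v₁, v₂}).toAddSubgroup := by
    ext v
    simp [φ, Submodule.mem_span_pair, Fintype.linearCombination_apply, Fin.exists_fin_succ_pi]
  rw [← hφ, ← AddSubgroup.relIndex_comap, AddSubgroup.relIndex_top_right]
  rfl

theorem relIndex_span_pair {V : Type*} [AddCommGroup V] {v₁ v₂ : V} {Λ : Submodule ℤ V}
    {M : ℕ} {s t : ℤ} (hM : 0 < M) (hst : IsCoprime s t)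
    (hmem : ∀ x y : ℤ, x • v₁ + y • v₂ ∈ Λ ↔ (M : ℤ) ∣ s * x + t * y) :
    Λ.toAddSubgroup.relIndex (Submodule.span ℤ {v₁, v₂}).toAddSubgroup = M := by
  rw [relIndex_span_pair_eq_index]
  refine index_of_congruence _ hM hst fun v => ?_
  rw [← hmem]
  simp [Fintype.linearCombination_apply]

theorem span_smul_le {V : Type*} [AddCommGroup V] {v₁ v₂ : V} (d : ℤ) :
    Submodule.span ℤ {d • v₁, v₂} ≤ Submodule.span ℤ {v₁, v₂} := by
  rw [Submodule.span_le]
  rintro _ (rfl | rfl)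
  · exact Submodule.smul_mem _ _ (Submodule.subset_span (by simp))
  · exact Submodule.subset_span (by simp)

namespace IsFrame

variable {V : Type*} [AddCommGroup V] [Module ℚ V] {X : Fin 3 → V →ₗ[ℚ] V} {Δ m₀ : ℤ}
  {v₁ v₂ : V} {c e b : Fin 3 → ℤ}

theorem relIndex_span_smul (h : IsFrame X Δ m₀ v₁ v₂ c e b) {d : ℕ} (hd : 0 < d) :
    (Submodule.span ℤ {(d : ℤ) • v₁, v₂}).toAddSubgroup.relIndex
      (Submodule.span ℤ {v₁, v₂}).toAddSubgroup = d :=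
  relIndex_span_pair (s := 1) (t := 0) hd isCoprime_one_left fun x y => by
    rw [h.mem_span_smul_iff]; simp

theorem le_span_smul_iff
    (h : IsFrame X Δ m₀ v₁ v₂ c e b) {Λ : Submodule ℤ V}
    (hΛ : Λ ≤ Submodule.span ℤ {v₁, v₂}) {M d : ℕ} {s t : ℤ} (hM : 0 < M) (hd : 0 < d)
    (hst : IsCoprime s t) (hmem : ∀ x y : ℤ, x • v₁ + y • v₂ ∈ Λ ↔ (M : ℤ) ∣ s * x + t * y) :
    Λ ≤ Submodule.span ℤ {(d : ℤ) • v₁, v₂} ↔ d ∣ M ∧ (d : ℤ) ∣ t := by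
  constructor
  · intro hle
    have h1 := AddSubgroup.relIndex_mul_relIndex Λ.toAddSubgroup
      (Submodule.span ℤ {(d : ℤ) • v₁, v₂}).toAddSubgroup
      (Submodule.span ℤ {v₁, v₂}).toAddSubgroup hle (span_smul_le d)
    rw [h.relIndex_span_smul hd, relIndex_span_pair hM hst hmem] at h1
    exact ⟨⟨_, by rw [← h1, mul_comm]⟩,
      (h.mem_span_smul_iff d t (-s)).1 (hle ((hmem _ _).2 ⟨0, by ring⟩))⟩
  · rintro ⟨hdM, hdt⟩ v hv
    obtain ⟨x, y, rfl⟩ := Submodule.mem_span_pair.1 (hΛ hv)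
    rw [h.mem_span_smul_iff]
    have h1 := (Int.natCast_dvd_natCast.2 hdM).trans ((hmem x y).1 hv)
    have h2 := (dvd_add_left (hdt.mul_right y)).1 h1
    exact (hst.symm.of_isCoprime_of_dvd_left hdt).dvd_of_dvd_mul_left h2

theorem exists_divisor_iff
    (h : IsFrame X Δ m₀ v₁ v₂ c e b) {Λ : Submodule ℤ V}
    (hΛ : Λ ≤ Submodule.span ℤ {v₁, v₂}) {M m n : ℕ} {s t : ℤ} (hM : 0 < M)
    (hst : IsCoprime s t) (hmem : ∀ x y : ℤ, x • v₁ + y • v₂ ∈ Λ ↔ (M : ℤ) ∣ s * x + t * y) :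
    (∃ d : ℕ, 0 < d ∧ d ∣ n ∧ Λ ≤ Submodule.span ℤ {(d : ℤ) • v₁, v₂} ∧
      Λ.toAddSubgroup.relIndex (Submodule.span ℤ {(d : ℤ) • v₁, v₂}).toAddSubgroup ∣ m) ↔
      M ∣ m * n ∧ (M : ℤ) ∣ m * t := by
  have hindex : ∀ d : ℕ, 0 < d → Λ ≤ Submodule.span ℤ {(d : ℤ) • v₁, v₂} →
      Λ.toAddSubgroup.relIndex (Submodule.span ℤ {(d : ℤ) • v₁, v₂}).toAddSubgroup * d = M := by
    intro d hd hle
    have h1 := AddSubgroup.relIndex_mul_relIndex Λ.toAddSubgroup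
      (Submodule.span ℤ {(d : ℤ) • v₁, v₂}).toAddSubgroup
      (Submodule.span ℤ {v₁, v₂}).toAddSubgroup hle (span_smul_le d)
    rwa [h.relIndex_span_smul hd, relIndex_span_pair hM hst hmem] at h1
  constructor
  · rintro ⟨d, hd, hdn, hle, hm⟩
    have hdt := ((h.le_span_smul_iff hΛ hM hd hst hmem).1 hle).2
    have hMd := hindex d hd hle
    have hMd' := congrArg (Nat.cast : ℕ → ℤ) hMd
    push_cast at hMd'
    exact ⟨hMd ▸ mul_dvd_mul hm hdn, hMd' ▸ mul_dvd_mul (Int.natCast_dvd_natCast.2 hm) hdt⟩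
  · rintro ⟨h1, h2⟩
    have h3 : M ∣ m * t.natAbs := by
      simpa [Int.natAbs_mul] using Int.natAbs_dvd_natAbs.2 h2
    obtain ⟨d, hd⟩ : ∃ d, d = Nat.gcd M (Nat.gcd n t.natAbs) := ⟨_, rfl⟩
    have hd0 : 0 < d := hd ▸ Nat.gcd_pos_of_pos_left _ hM
    have hdg : d ∣ Nat.gcd n t.natAbs := hd ▸ Nat.gcd_dvd_right _ _
    have hle : Λ ≤ Submodule.span ℤ {(d : ℤ) • v₁, v₂} :=
      (h.le_span_smul_iff hΛ hM hd0 hst hmem).2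
        ⟨hd ▸ Nat.gcd_dvd_left _ _, Int.natCast_dvd.2 (hdg.trans (Nat.gcd_dvd_right _ _))⟩
    refine ⟨d, hd0, hdg.trans (Nat.gcd_dvd_left _ _), hle, ?_⟩
    refine Nat.dvd_of_mul_dvd_mul_right hd0 ?_
    rw [hindex d hd0 hle, hd, ← Nat.gcd_mul_left, ← Nat.gcd_mul_left]
    exact Nat.dvd_gcd (dvd_mul_left _ _) (Nat.dvd_gcd h1 h3)

end IsFrame

theorem exists_prime_mul_maximal {P : ℕ → Prop} (h1 : P 1) {N : ℕ} (hN : N ≠ 0)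
    (hP : ∀ k, P k → k ∣ N) : ∃ k, k ≠ 0 ∧ P k ∧ ∀ p : ℕ, p.Prime → ¬ P (p * k) := by
  classical
  have hk : P (Nat.findGreatest P N) := Nat.findGreatest_spec (Nat.one_le_iff_ne_zero.2 hN) h1
  have hk0 : Nat.findGreatest P N ≠ 0 := fun h0 => hN (by simpa [h0] using hP _ hk)
  refine ⟨_, hk0, hk, fun p hp hpk => ?_⟩
  have h2 := Nat.le_findGreatest (Nat.le_of_dvd (Nat.pos_of_ne_zero hN) (hP _ hpk)) hpk
  have h3 := Nat.mul_le_mul_right (Nat.findGreatest P N) hp.two_le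
  omega

/-- The three non-identity generators of `Rring A B C D`, acting on `ℚ²`. -/
def ringGenerators (A B C D : ℤ) : Fin 3 → (Fin 2 → ℚ) →ₗ[ℚ] (Fin 2 → ℚ) := fun i =>
  ((![!![B, C; -A, 0], !![0, 0; 0, D], !![0, 0; D, 0]] i).map (Int.cast : ℤ → ℚ)).mulVecLin

theorem forall_mem_Rring_iff (A B C D : ℤ) (Λ : Submodule ℤ (Fin 2 → ℚ)) :
    (∀ M ∈ Rring A B C D, ∀ v ∈ Λ, (M.map (Int.cast : ℤ → ℚ)).mulVec v ∈ Λ) ↔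
      ∀ i, ∀ v ∈ Λ, ringGenerators A B C D i v ∈ Λ := by
  constructor
  · intro h i v hv
    refine h _ (Submodule.subset_span ?_) v hv
    fin_cases i <;> simp
  · intro h M hM v hv
    induction hM using Submodule.span_induction with
    | mem M hM =>
      rcases hM with rfl | rfl | rfl | rfl
      · simpa using hv
      · exact h 0 v hv
      · exact h 1 v hv
      · exact h 2 v hv
    | zero => simp
    | add M N _ _ hM hN =>
      rw [Matrix.map_add _ Int.cast_add, Matrix.add_mulVec]
      exact Λ.add_mem hM hN
    | smul k M _ hM =>
      have : ((k • M).map (Int.cast : ℤ → ℚ)).mulVec v =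
          k • (M.map (Int.cast : ℤ → ℚ)).mulVec v := by
        rw [← Matrix.smul_mulVec]
        congr 1
        ext i j
        simp [-zsmul_eq_mul, zsmul_eq_mul (M i j : ℚ)]
      rw [this]
      exact Λ.smul_mem k hM

theorem isFrame_standard (A B C D : ℤ) :
    IsFrame (ringGenerators A B C D) (C * D ^ 2) 1 (Pi.single 0 1) (Pi.single 1 1)
      ![-A, 0, D] ![B, -D, 0] ![C, 0, 0] where
  linearIndependent := LinearIndependent.pair_iff.2 fun x y hxy =>
    ⟨by simpa using congrFun hxy 0, by simpa using congrFun hxy 1⟩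
  action i := by
    refine ⟨![B, 0, 0] i, ![0, D, 0] i, ?_, ?_, ?_⟩
    · ext j
      fin_cases i <;> fin_cases j <;> simp [ringGenerators]
    · ext j
      fin_cases i <;> fin_cases j <;> simp [ringGenerators]
    · fin_cases i <;> simp
  disc := by simp [Matrix.det_fin_three]; ring

theorem exists_scaled_congruence {V : Type*} [AddCommGroup V] {v₁ v₂ : V} {Λ : Submodule ℤ V}
    (hfin : Λ.toAddSubgroup.relIndex (Submodule.span ℤ {v₁, v₂}).toAddSubgroup ≠ 0)
    (hΛ : Λ ≤ Submodule.span ℤ {v₁, v₂})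
    (hprim : ∀ p : ℕ, p.Prime → ∃ v ∈ Λ, ∀ w ∈ Submodule.span ℤ {v₁, v₂}, v ≠ (p : ℤ) • w) :
    ∃ (M : ℕ) (s t : ℤ), 0 < M ∧ IsCoprime s t ∧
      ∀ x y : ℤ, x • v₁ + y • v₂ ∈ Λ ↔ (M : ℤ) ∣ s * x + t * y := by
  let φ := Fintype.linearCombination ℤ ![v₁, v₂]
  have hφ : ∀ x, φ x = x 0 • v₁ + x 1 • v₂ := fun x => by
    simp [φ, Fintype.linearCombination_apply]
  obtain ⟨M, s, t, hM, hst, hmem⟩ := exists_congruence (Λ.comap φ) (by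
    rw [relIndex_span_pair_eq_index] at hfin; exact hfin) (by
    intro p hp
    obtain ⟨v, hv, hvp⟩ := hprim p hp
    obtain ⟨x, y, rfl⟩ := Submodule.mem_span_pair.1 (hΛ hv)
    refine ⟨![x, y], by simpa [hφ] using hv, fun w hw => ?_⟩
    refine hvp (φ w) (Submodule.mem_span_pair.2 ⟨_, _, (hφ w).symm⟩) ?_
    rw [← map_smul, ← hw, hφ]
    rfl)
  refine ⟨M, s, t, hM, hst, fun x y => ?_⟩
  have := hmem ![x, y]
  simpa [hφ] using this

/-- Theorem 5.2, classification of invariant lattices: there exist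
positive integers `m, n` with `n·m² ∣ C·D²` and a `ℚ`-basis `(v₁, v₂)` of `ℚ²` such that a
full-rank primitive sublattice `Λ` of `Λ₀ = ℤv₁ + ℤv₂` is `R_{A,B,C,D}`-invariant if and
only if `Λ ⊆ Λ_d = ℤ(d·v₁) + ℤv₂` with index dividing `m`, for some positive divisor `d`
of `n`. -/
theorem stmt16 (A B C D : ℤ) (hC : 1 ≤ C) (hD : 1 ≤ D) :
    ∃ m n : ℕ, 0 < m ∧ 0 < n ∧ ((n : ℤ) * (m : ℤ) ^ 2) ∣ C * D ^ 2 ∧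
      ∃ v₁ v₂ : Fin 2 → ℚ, LinearIndependent ℚ ![v₁, v₂] ∧
        ∀ Λ : Submodule ℤ (Fin 2 → ℚ),
          Λ ≤ Submodule.span ℤ {v₁, v₂} →
          (Λ.toAddSubgroup.addSubgroupOf
            (Submodule.span ℤ {v₁, v₂}).toAddSubgroup).index ≠ 0 →
          (∀ p : ℕ, p.Prime →
            ∃ v ∈ Λ, ∀ w ∈ Submodule.span ℤ {v₁, v₂}, v ≠ (p : ℚ) • w) →
          ((∀ M ∈ Rring A B C D, ∀ v ∈ Λ, (M.map (Int.cast : ℤ → ℚ)).mulVec v ∈ Λ) ↔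
            ∃ d : ℕ, 0 < d ∧ d ∣ n ∧
              Λ ≤ Submodule.span ℤ {(d : ℚ) • v₁, v₂} ∧
              (Λ.toAddSubgroup.addSubgroupOf
                (Submodule.span ℤ {(d : ℚ) • v₁, v₂}).toAddSubgroup).index ∣ m) := by
  have hΔ : C * D ^ 2 ≠ 0 := by positivity
  set X := ringGenerators A B C D
  obtain ⟨m, hm0, hm, hm_max⟩ := exists_prime_mul_maximal
    (P := fun m => ∃ v₁ v₂ c e b, IsFrame X (C * D ^ 2) m v₁ v₂ c e b)
    ⟨_, _, _, _, _, by exact_mod_cast isFrame_standard A B C D⟩ (Int.natAbs_ne_zero.2 hΔ) (by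
      rintro k ⟨v₁, v₂, c, e, b, h⟩
      have h1 := h.mul_pow_dvd (n := 1) fun i => one_dvd _
      rw [one_mul] at h1
      exact Int.natCast_dvd.1 ((dvd_pow_self _ three_ne_zero).trans h1))
  obtain ⟨n, hn0, ⟨v₁, v₂, c, e, b, h, hb⟩, hn_max⟩ := exists_prime_mul_maximal
    (P := fun n => ∃ v₁ v₂ c e b, IsFrame X (C * D ^ 2) m v₁ v₂ c e b ∧ ∀ i, (n : ℤ) ∣ b i)
    (by
      obtain ⟨v₁, v₂, c, e, b, h⟩ := hm
      exact ⟨v₁, v₂, c, e, b, h, by simp⟩) (Int.natAbs_ne_zero.2 hΔ) (by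
      rintro k ⟨v₁, v₂, c, e, b, h, hk⟩
      exact Int.natCast_dvd.1 ((dvd_mul_right _ _).trans (h.mul_pow_dvd hk)))
  refine ⟨m, n, Nat.pos_of_ne_zero hm0, Nat.pos_of_ne_zero hn0,
    (mul_dvd_mul_left _ (pow_dvd_pow _ (by norm_num))).trans (h.mul_pow_dvd hb),
    v₁, v₂, h.linearIndependent, fun Λ hΛ hfin hprim => ?_⟩
  obtain ⟨M, s, t, hM, hst, hmem⟩ := exists_scaled_congruence hfin hΛ fun p hp => by
    obtain ⟨v, hv, hvw⟩ := hprim p hp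
    exact ⟨v, hv, fun w hw => by simpa [Nat.cast_smul_eq_nsmul] using hvw w hw⟩
  have hd : ∀ d : ℕ, (d : ℚ) • v₁ = (d : ℤ) • v₁ := fun d => by
    rw [Nat.cast_smul_eq_nsmul, natCast_zsmul]
  simp only [hd]
  rw [forall_mem_Rring_iff, h.invariant_iff hΛ hst hmem]
  refine Iff.trans ?_
    (h.exists_divisor_iff hΛ hM hst hmem (m := m)).symm
  obtain ⟨g, M', m', hg, hcop, rfl, rfl⟩ :=
    Nat.exists_coprime' (Nat.gcd_pos_of_pos_left m hM)
  have hcancel : ∀ z : ℤ, ((M' * g : ℕ) : ℤ) ∣ ((m' * g : ℕ) : ℤ) * z ↔ (M' : ℤ) ∣ z := by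
    intro z
    have h1 : ((m' * g : ℕ) : ℤ) * z = m' * z * g := by push_cast; ring
    rw [h1, Nat.cast_mul, mul_dvd_mul_iff_right (by exact_mod_cast hg.ne')]
    exact ⟨(Nat.isCoprime_iff_coprime.2 hcop : IsCoprime (M' : ℤ) m').dvd_of_dvd_mul_left,
      fun hz => hz.mul_left _⟩
  have hcancel_nat : M' * g ∣ m' * g * n ↔ M' ∣ n := by
    rw [← Int.natCast_dvd_natCast, Nat.cast_mul (m' * g), hcancel, Int.natCast_dvd_natCast]
  simp only [hcancel, hcancel_nat]
  constructor
  · refine h.dvd_of_maximal hb hn0 (fun p hp v₁ v₂ c e b h' => ?_)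
      (fun p hp v₁ v₂ c e b h' hb' => hn_max p hp ⟨v₁, v₂, c, e, b, h', hb'⟩) hst
    exact hm_max p hp ⟨v₁, v₂, c, e, b, by rwa [Nat.cast_mul p]⟩
  · rintro ⟨hMn, hMt⟩ i
    have hMb := (Int.natCast_dvd_natCast.2 hMn).trans (hb i)
    exact (((dvd_pow hMt two_ne_zero).mul_left _).add ((hMt.mul_left _).mul_left _)).sub
      (hMb.mul_right _)

end
end

section
/- Let p be a prime and let R ⊆ Mat₂(ℤ_p) be a subring containing the identity matrix, of finite index as an additive subgroup, and satisfying R ⊆ ℤ_p·I + p·Mat₂(ℤ_p) (every element of R is congruent to a scalar matrix modulo p). Let B = {M ∈ Mat₂(ℤ_p) : p·M ∈ R}, and let R' be the subring of Mat₂(ℤ_p) generated by B. Let Λ ⊆ ℤ_p² be a full-rank ℤ_p-submodule with Λ ≠ ℤ_p² and Λ ⊄ p·ℤ_p², and set Λ' = {v ∈ ℤ_p² : p·v ∈ Λ}. Then M·Λ ⊆ Λ for all M ∈ R if and only if M·Λ' ⊆ Λ' for all M ∈ R'. -/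
noncomputable section

namespace PadicInt

variable {p : ℕ} [Fact p.Prime]

theorem exists_natCast_add_natCast_mul {k : ℕ} (hk : k ≠ 0) (c : ℤ_[p]) :
    ∃ (n : ℕ) (s : ℤ_[p]), c = n + k * s := by
  have hk' : (k : ℤ_[p]) ≠ 0 := Nat.cast_ne_zero.mpr hk
  obtain ⟨t, ht⟩ := Ideal.mem_span_singleton.mp
    (appr_spec (valuation (k : ℤ_[p])) c)
  have hu := unitCoeff_spec hk'
  have hi := (unitCoeff hk').mul_inv
  refine ⟨c.appr (valuation (k : ℤ_[p])), ((unitCoeff hk')⁻¹ : ℤ_[p]ˣ) * t, ?_⟩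
  linear_combination ht - ((unitCoeff hk')⁻¹ : ℤ_[p]ˣ) * t * hu
    - (p : ℤ_[p]) ^ valuation (k : ℤ_[p]) * t * hi

theorem smul_one_mem_of_index_ne_zero {A : Type*} [Ring A] [Module ℤ_[p] A]
    (R : Subring A) (hR : R.toAddSubgroup.index ≠ 0) (c : ℤ_[p]) : c • (1 : A) ∈ R := by
  obtain ⟨n, s, rfl⟩ := exists_natCast_add_natCast_mul hR c
  rw [add_smul, mul_smul, Nat.cast_smul_eq_nsmul, Nat.cast_smul_eq_nsmul]
  exact R.add_mem (R.nsmul_mem R.one_mem n)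
    (R.toAddSubgroup.nsmul_index_mem (s • (1 : A)))

theorem exists_det_eq_one_of_primitive {v : Fin 2 → ℤ_[p]}
    (hv : ∀ w : Fin 2 → ℤ_[p], v ≠ (p : ℤ_[p]) • w) :
    ∃ e : Fin 2 → ℤ_[p], v 0 * e 1 - v 1 * e 0 = 1 := by
  by_cases h0 : IsUnit (v 0)
  · obtain ⟨b, hb⟩ := h0.exists_right_inv
    exact ⟨![0, b], by simp [hb]⟩
  by_cases h1 : IsUnit (v 1)
  · obtain ⟨b, hb⟩ := h1.exists_right_inv
    exact ⟨![-b, 0], by simp [hb]⟩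
  rw [← mem_nonunits_iff, mem_nonunits, norm_lt_one_iff_dvd] at h0 h1
  obtain ⟨a, ha⟩ := h0
  obtain ⟨b, hb⟩ := h1
  refine absurd ?_ (hv ![a, b])
  ext i
  fin_cases i <;> simp [ha, hb]

end PadicInt

/-- If `M` maps a vector `v ∈ Λ` belonging to a basis of `A²` into `{u | c • u ∈ Λ}`, then it
preserves `{u | c • u ∈ Λ}`. -/
theorem Submodule.smul_mulVec_mem_of_det_eq_one {A : Type*} [CommRing A] (c : A)
    (Λ : Submodule A (Fin 2 → A)) (M : Matrix (Fin 2) (Fin 2) A) {v e u : Fin 2 → A}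
    (hv : v ∈ Λ) (he : v 0 * e 1 - v 1 * e 0 = 1) (hMv : c • M.mulVec v ∈ Λ)
    (hu : c • u ∈ Λ) : c • M.mulVec u ∈ Λ := by
  set d := v 0 * u 1 - v 1 * u 0 with hd
  have hdu : u = (u 0 * e 1 - u 1 * e 0) • v + d • e := by
    ext i
    fin_cases i <;> simp [hd]
    · linear_combination -u 0 * he
    · linear_combination -u 1 * he
  have hcramer (w : Fin 2 → A) : c • d • w ∈ Λ := by
    have h : c • d • w =
        (c * (w 0 * u 1 - w 1 * u 0)) • v + (v 0 * w 1 - v 1 * w 0) • c • u := by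
      ext i
      fin_cases i <;> simp [hd] <;> ring
    rw [h]
    exact Λ.add_mem (Λ.smul_mem _ hv) (Λ.smul_mem _ hu)
  rw [hdu, Matrix.mulVec_add, Matrix.mulVec_smul, Matrix.mulVec_smul, smul_add, smul_comm c]
  exact Λ.add_mem (Λ.smul_mem _ hMv) (hcramer _)

/-- key step of Lemma 5.3: let `R ⊆ Mat₂(ℤ_p)` be a subring of finite
additive index all of whose elements are scalar modulo `p`, let `B = {M : p·M ∈ R}` and `R'`
the subring generated by `B`.  For a full-rank lattice `Λ ⊊ ℤ_p²` not contained in `p·ℤ_p²`,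
with `Λ' = (1/p)Λ ∩ ℤ_p²`, one has: `Λ` is `R`-invariant iff `Λ'` is `R'`-invariant. -/
theorem stmt17 (p : ℕ) [Fact p.Prime]
    (R : Subring (Matrix (Fin 2) (Fin 2) (PadicInt p)))
    (hfin : R.toAddSubgroup.index ≠ 0)
    (hscalar : ∀ M ∈ R, ∃ (c : PadicInt p) (N : Matrix (Fin 2) (Fin 2) (PadicInt p)),
      M = c • (1 : Matrix (Fin 2) (Fin 2) (PadicInt p)) + (p : PadicInt p) • N)
    (R' : Subring (Matrix (Fin 2) (Fin 2) (PadicInt p)))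
    (hR' : R' = Subring.closure
      {M : Matrix (Fin 2) (Fin 2) (PadicInt p) | (p : PadicInt p) • M ∈ R})
    (Λ : Submodule (PadicInt p) (Fin 2 → PadicInt p))
    (hfull : Λ.toAddSubgroup.index ≠ 0)
    (hne : Λ ≠ ⊤)
    (hprim : ∃ v ∈ Λ, ∀ w : Fin 2 → PadicInt p, v ≠ (p : PadicInt p) • w)
    (Λ' : Submodule (PadicInt p) (Fin 2 → PadicInt p))
    (hΛ' : ∀ v : Fin 2 → PadicInt p, v ∈ Λ' ↔ (p : PadicInt p) • v ∈ Λ) :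
    (∀ M ∈ R, ∀ v ∈ Λ, M.mulVec v ∈ Λ) ↔
      (∀ M ∈ R', ∀ v ∈ Λ', M.mulVec v ∈ Λ') := by
  subst hR'
  constructor
  · intro h M hM
    obtain ⟨v, hv, hvprim⟩ := hprim
    obtain ⟨e, he⟩ := PadicInt.exists_det_eq_one_of_primitive hvprim
    induction hM using Subring.closure_induction with
    | mem M hM =>
      intro u hu
      rw [hΛ'] at hu ⊢
      refine Λ.smul_mulVec_mem_of_det_eq_one _ M hv he ?_ hu
      rw [← Matrix.smul_mulVec]
      exact h _ hM v hv
    | zero => simp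
    | one => simp
    | add M N _ _ hM hN =>
      intro u hu
      rw [Matrix.add_mulVec]
      exact Λ'.add_mem (hM u hu) (hN u hu)
    | neg M _ hM =>
      intro u hu
      rw [Matrix.neg_mulVec]
      exact Λ'.neg_mem (hM u hu)
    | mul M N _ _ hM hN =>
      intro u hu
      rw [← Matrix.mulVec_mulVec]
      exact hM _ (hN u hu)
  · intro h M hM v hv
    obtain ⟨c, N, rfl⟩ := hscalar M hM
    have hN : (p : PadicInt p) • N ∈ R := by
      simpa using R.sub_mem hM (PadicInt.smul_one_mem_of_index_ne_zero R hfin c)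
    have hNv := h N (Subring.subset_closure hN) v ((hΛ' v).mpr (Λ.smul_mem _ hv))
    rw [Matrix.add_mulVec, Matrix.smul_mulVec, Matrix.smul_mulVec, Matrix.one_mulVec]
    exact Λ.add_mem (Λ.smul_mem _ hv) ((hΛ' _).mp hNv)

end
end

section
/- Let p be an odd prime and let a be an integer that is not a quadratic residue modulo p (there is no x ∈ ℤ with x² ≡ a mod p). Let R ⊆ Mat₂(ℤ) be the ℤ-span of the matrices [[1,0],[0,1]], [[0,1],[a,0]], [[0,0],[0,p]], [[0,0],[p,0]] (the ring R_{−a,0,1,p}). Then every full-rank ℤ-submodule Λ ⊆ ℚ² satisfying M·Λ ⊆ Λ for all M ∈ R is of the form q·ℤ² for some nonzero rational q; that is, up to scaling, ℤ² is the only R-invariant lattice. -/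
noncomputable section

open scoped nonZeroDivisors in
theorem Submodule.FG.exists_eq_span_singleton_rat {X : Submodule ℤ ℚ} (hX : X.FG) :
    ∃ t : ℚ, X = Submodule.span ℤ {t} := by
  let I : FractionalIdeal ℤ⁰ ℚ := ⟨X, FractionalIdeal.isFractional_of_fg hX⟩
  have : (I : Submodule ℤ ℚ).IsPrincipal := inferInstance
  exact this.principal

/-- for `p` an odd prime and `a` a quadratic non-residue mod `p`, the only
`R_{-a,0,1,p}`-invariant lattice in `ℚ²`, up to scaling, is `ℤ²`. -/
theorem stmt18 (p : ℕ) (hp : p.Prime) (hodd : Odd p) (a : ℤ)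
    (ha : ¬ ∃ x : ℤ, (p : ℤ) ∣ x ^ 2 - a)
    (Λ : Submodule ℤ (Fin 2 → ℚ)) (hfg : Λ.FG)
    (hfull : Submodule.span ℚ (Λ : Set (Fin 2 → ℚ)) = ⊤)
    (hinv : ∀ M ∈ Rring (-a) 0 1 (p : ℤ), ∀ v ∈ Λ,
      (M.map (Int.cast : ℤ → ℚ)).mulVec v ∈ Λ) :
    ∃ q : ℚ, q ≠ 0 ∧ Λ = Submodule.span ℤ {![q, 0], ![0, q]} := by
  have hJ : ∀ x y : ℚ, ![x, y] ∈ Λ → ![y, a * x] ∈ Λ := by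
    intro x y h
    have := hinv !![0, 1; -(-a), 0] (Submodule.subset_span (by simp)) _ h
    convert this using 1
    ext i; fin_cases i <;> simp [Matrix.mulVec, dotProduct, Fin.sum_univ_two]
  have hF : ∀ x y : ℚ, ![x, y] ∈ Λ → ![0, p * x] ∈ Λ := by
    intro x y h
    have := hinv !![0, 0; (p : ℤ), 0] (Submodule.subset_span (by simp)) _ h
    convert this using 1
    ext i; fin_cases i <;> simp [Matrix.mulVec, dotProduct, Fin.sum_univ_two]
  have heta : ∀ v : Fin 2 → ℚ, v = ![v 0, v 1] := fun v ↦ by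
    ext i; fin_cases i <;> rfl
  obtain ⟨t, ht⟩ :=
    (hfg.map (LinearMap.proj (R := ℤ) (φ := fun _ : Fin 2 ↦ ℚ) 0)).exists_eq_span_singleton_rat
  have hfst : ∀ x y : ℚ, ![x, y] ∈ Λ → ∃ m : ℤ, x = m * t := by
    intro x y h
    have : x ∈ Λ.map (LinearMap.proj (R := ℤ) (φ := fun _ : Fin 2 ↦ ℚ) 0) := ⟨_, h, by simp⟩
    rw [ht, Submodule.mem_span_singleton] at this
    obtain ⟨m, hm⟩ := this
    exact ⟨m, by simpa using hm.symm⟩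
  have hcoord : ∀ v ∈ Λ, ∃ m n : ℤ, v = ![m * t, n * t] := by
    intro v hv
    rw [heta v] at hv
    obtain ⟨m, hm⟩ := hfst _ _ hv
    obtain ⟨n, hn⟩ := hfst _ _ (hJ _ _ hv)
    exact ⟨m, n, by rw [heta v, hm, hn]⟩
  have ht0 : t ≠ 0 := by
    rintro rfl
    have hbot : Submodule.span ℚ (Λ : Set (Fin 2 → ℚ)) = ⊥ := by
      rw [Submodule.span_eq_bot]
      intro v hv
      obtain ⟨m, n, rfl⟩ := hcoord v hv
      simp
    exact bot_ne_top (hbot.symm.trans hfull)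
  obtain ⟨n, hn⟩ : ∃ n : ℤ, ![t, n * t] ∈ Λ := by
    have : t ∈ Λ.map (LinearMap.proj (R := ℤ) (φ := fun _ : Fin 2 ↦ ℚ) 0) :=
      ht ▸ Submodule.mem_span_singleton_self t
    obtain ⟨v, hv, hvt⟩ := this
    obtain ⟨m, n, rfl⟩ := hcoord v hv
    have hm : m * t = t := by simpa using hvt
    exact ⟨n, by simpa [hm] using hv⟩
  have hcop : IsCoprime (p : ℤ) (n ^ 2 - a) :=
    ((Nat.prime_iff_prime_int.mp hp).coprime_iff_not_dvd).mpr fun h ↦ ha ⟨n, h⟩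
  obtain ⟨u, w, huw⟩ := hcop
  have huw' : (u * p + w * (n ^ 2 - a) : ℚ) = 1 := by exact_mod_cast huw
  have h01 : ![0, t] ∈ Λ := by
    have := Λ.add_mem (Λ.smul_mem u (hF _ _ hn))
      (Λ.smul_mem w (Λ.sub_mem (Λ.smul_mem n hn) (hJ _ _ hn)))
    convert this using 1
    ext i; fin_cases i
    · simp
    · simp
      linear_combination (-t) * huw'
  have h10 : ![t, 0] ∈ Λ := by simpa using hJ _ _ h01
  refine ⟨t, ht0, le_antisymm (fun v hv ↦ ?_) ?_⟩
  · obtain ⟨m, n, rfl⟩ := hcoord v hv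
    exact Submodule.mem_span_pair.mpr ⟨m, n, by simp⟩
  · rw [Submodule.span_le]
    rintro v (rfl | rfl)
    exacts [h10, h01]

end
end

section
/- Let n be a positive integer. (i) For every irrational real ξ: max over positive divisors d of n of λ(d·ξ) = limsup_{q ∈ ℚ, q → ξ} gcd(den(q), n)/(den(q)² · |q − ξ|). (ii) For all distinct irrational reals ξ, ξ': max over positive divisors d of n of μ(d·ξ, d·ξ') = sup_{(s,t) ∈ ℤ²∖{(0,0)}} |ξ − ξ'| · gcd(t, n) / |(s − t·ξ)(s − t·ξ')|, where gcd(0,n) = n. Both equalities hold in [0,∞]. -/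
noncomputable section
open Filter Topology
open scoped ENNReal LinearAlgebra.Projectivization

theorem Rat.den_natCast_mul (d : ℕ) (q : ℚ) : ((d : ℚ) * q).den = q.den / Nat.gcd q.den d := by
  rw [Rat.mul_den]
  simp only [Rat.den_natCast, one_mul, Rat.num_natCast, Int.natAbs_mul, Int.natAbs_natCast]
  rw [Nat.Coprime.gcd_mul_right_cancel d q.reduced, Nat.gcd_comm]

/-- The approximation quality of `d q` to `d ξ`, in terms of that of `q` to `ξ`. -/
theorem one_div_den_sq_natCast_mul {d : ℕ} (hd : 0 < d) (ξ : ℝ) (q : ℚ) :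
    1 / ((((d : ℚ) * q).den : ℝ) ^ 2 * |(((d : ℚ) * q : ℚ) : ℝ) - d * ξ|) =
      (Nat.gcd q.den d : ℝ) ^ 2 / d / ((q.den : ℝ) ^ 2 * |(q : ℝ) - ξ|) := by
  have hd' : (0 : ℝ) < d := by exact_mod_cast hd
  have hg : (Nat.gcd q.den d : ℝ) ≠ 0 := by
    exact_mod_cast (Nat.gcd_pos_of_pos_right _ hd).ne'
  rw [Rat.den_natCast_mul, Nat.cast_div (Nat.gcd_dvd_left _ _) hg]
  push_cast
  rw [← mul_sub, abs_mul, abs_of_pos hd', div_pow]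
  field_simp

theorem lambdaCl_natCast_mul {d : ℕ} (hd : 0 < d) (ξ : ℝ) :
    lambdaCl (d * ξ) =
      limsup (fun q : ℚ => ENNReal.ofReal
        ((Nat.gcd q.den d : ℝ) ^ 2 / d / ((q.den : ℝ) ^ 2 * |(q : ℝ) - ξ|)))
        (comap (fun q : ℚ => (q : ℝ)) (𝓝 ξ)) := by
  have hq : (d : ℚ) ≠ 0 := by exact_mod_cast hd.ne'
  have hr : (d : ℝ) ≠ 0 := by exact_mod_cast hd.ne'
  have hmap : comap (fun q : ℚ => (q : ℝ)) (𝓝 (d * ξ)) =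
      map (fun q : ℚ => (d : ℚ) * q) (comap (fun q : ℚ => (q : ℝ)) (𝓝 ξ)) := by
    have h := (Homeomorph.mulLeft₀ (d : ℝ) hr).comap_nhds_eq (d * ξ)
    have hs : (Homeomorph.mulLeft₀ (d : ℝ) hr).symm (d * ξ) = ξ :=
      (Homeomorph.mulLeft₀ (d : ℝ) hr).symm_apply_apply ξ
    rw [hs] at h
    rw [← h, comap_comap]
    have hc : (⇑(Homeomorph.mulLeft₀ (d : ℝ) hr) ∘ fun q : ℚ => (q : ℝ)) =
        (fun q : ℚ => (q : ℝ)) ∘ (Equiv.mulLeft₀ (d : ℚ) hq) := by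
      ext q
      simp
    rw [hc, ← comap_comap]
    exact (map_comap_of_surjective (Equiv.mulLeft₀ (d : ℚ) hq).surjective _).symm
  rw [lambdaCl, hmap, ← limsup_comp]
  simp only [Function.comp_def, one_div_den_sq_natCast_mul hd]

theorem iSup_divisors_lambdaCl {n : ℕ} (hn : 0 < n) (ξ : ℝ) :
    (⨆ d ∈ n.divisors, lambdaCl ((d : ℝ) * ξ)) = nLagrange n ξ := by
  have hpos : ∀ d ∈ n.divisors, 0 < d := fun d hd => Nat.pos_of_mem_divisors hd
  rw [biSup_congr fun d hd => lambdaCl_natCast_mul (hpos d hd) ξ, ← Finset.sup_eq_iSup,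
    ← limsup_finset_sup, nLagrange]
  congr 1
  ext q
  apply le_antisymm
  · refine Finset.sup_le fun d hd => ENNReal.ofReal_le_ofReal ?_
    have hd0 : (0 : ℝ) < d := by exact_mod_cast hpos d hd
    have hgd : (Nat.gcd q.den d : ℝ) ≤ d := by
      exact_mod_cast Nat.gcd_le_right _ (hpos d hd)
    have hgn : (Nat.gcd q.den d : ℝ) ≤ Nat.gcd q.den n := by
      exact_mod_cast Nat.le_of_dvd (Nat.gcd_pos_of_pos_right _ hn)
        (Nat.gcd_dvd_gcd_of_dvd_right _ (Nat.dvd_of_mem_divisors hd))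
    gcongr
    rw [div_le_iff₀ hd0, sq]
    gcongr
  · have hg : Nat.gcd q.den n ∈ n.divisors :=
      Nat.mem_divisors.2 ⟨Nat.gcd_dvd_right _ _, hn.ne'⟩
    have hg0 : (Nat.gcd q.den n : ℝ) ≠ 0 := by exact_mod_cast (hpos _ hg).ne'
    refine le_trans (le_of_eq ?_) (Finset.le_sup hg)
    rw [Nat.gcd_eq_right (Nat.gcd_dvd_left q.den n), sq (Nat.gcd q.den n : ℝ),
      mul_div_cancel_right₀ _ hg0]

theorem muCl_natCast_mul_le {n d : ℕ} (hn : 0 < n) (hd : d ∈ n.divisors) (ξ ξ' : ℝ) :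
    muCl (d * ξ) (d * ξ') ≤ nMarkoff n ξ ξ' := by
  have hd0 : 0 < d := Nat.pos_of_mem_divisors hd
  have hdn : d ∣ n := Nat.dvd_of_mem_divisors hd
  refine iSup₂_le fun st hst => ?_
  have hne : ((st.1, st.2 * d) : ℤ × ℤ) ≠ 0 := by
    intro h
    simp only [Prod.mk_eq_zero, mul_eq_zero, Int.natCast_eq_zero, hd0.ne', or_false] at h
    exact hst (Prod.ext h.1 h.2)
  rw [nMarkoff]
  refine le_iSup₂_of_le (st.1, st.2 * (d : ℤ)) hne (ENNReal.ofReal_le_ofReal ?_)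
  have hle : (d : ℝ) ≤ Int.gcd (st.2 * d) (n : ℤ) := by
    have h1 : d ∣ Int.gcd (st.2 * d) (n : ℤ) :=
      Int.dvd_gcd (Dvd.intro_left _ rfl) (by exact_mod_cast hdn)
    have h2 : 0 < Int.gcd (st.2 * d) (n : ℤ) :=
      Int.gcd_pos_of_ne_zero_right _ (by exact_mod_cast hn.ne')
    exact_mod_cast Nat.le_of_dvd h2 h1
  push_cast
  rw [← mul_sub, abs_mul (d : ℝ), Nat.abs_cast, mul_comm (d : ℝ), ← mul_assoc, ← mul_assoc]
  gcongr

theorem nMarkoff_le_iSup_muCl {n : ℕ} (hn : 0 < n) (ξ ξ' : ℝ) :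
    nMarkoff n ξ ξ' ≤ ⨆ d ∈ n.divisors, muCl ((d : ℝ) * ξ) ((d : ℝ) * ξ') := by
  refine iSup₂_le fun ⟨s, t⟩ hst => ?_
  have hmem : Int.gcd t n ∈ n.divisors :=
    Nat.mem_divisors.2 ⟨by exact_mod_cast Int.gcd_dvd_right t (n : ℤ), hn.ne'⟩
  refine le_trans ?_ (le_iSup₂ (Int.gcd t n) hmem)
  obtain ⟨u, hu⟩ := Int.gcd_dvd_left t (n : ℤ)
  set g := Int.gcd t (n : ℤ)
  have hne : ((s, u) : ℤ × ℤ) ≠ 0 := by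
    intro h
    simp only [Prod.mk_eq_zero] at h
    exact hst (by rw [hu, h.1, h.2, mul_zero]; rfl)
  refine le_trans (le_of_eq ?_) (le_iSup₂ (s, u) hne)
  have ht : (t : ℝ) = u * g := by rw [hu]; push_cast; ring
  simp only [ht]
  rw [← mul_sub, abs_mul (g : ℝ), Nat.abs_cast, mul_comm (g : ℝ), ← mul_assoc, ← mul_assoc]

/-- the `n`-Lagrange approximability of an irrational `ξ` is the maximum
over positive divisors `d` of `n` of the classical approximabilities `λ(d·ξ)`, and likewise
the `n`-Markoff approximability of a pair of distinct irrationals is the maximum of the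
classical Markoff approximabilities `μ(d·ξ, d·ξ')`. -/
theorem stmt19 (n : ℕ) (hn : 0 < n) :
    (∀ ξ : ℝ, Irrational ξ →
      (⨆ d ∈ n.divisors, lambdaCl ((d : ℝ) * ξ)) = nLagrange n ξ) ∧
    (∀ ξ ξ' : ℝ, Irrational ξ → Irrational ξ' → ξ ≠ ξ' →
      (⨆ d ∈ n.divisors, muCl ((d : ℝ) * ξ) ((d : ℝ) * ξ')) = nMarkoff n ξ ξ') := by
  refine ⟨fun ξ _ => iSup_divisors_lambdaCl hn ξ, fun ξ ξ' _ _ _ => le_antisymm ?_ ?_⟩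
  · exact iSup₂_le fun d hd => muCl_natCast_mul_le hn hd ξ ξ'
  · exact nMarkoff_le_iSup_muCl hn ξ ξ'

end
end
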